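/- arXiv:1404.3155 — 3 statements merged into one kernel-verified Lean document; each statement's English description precedes it below -/
import Mathlib

section
/- The class of finite simple graphs with strongly chordal treewidth at most two is closed under taking minors: if G has strongly chordal treewidth at most two and H is a minor of G, then H has strongly chordal treewidth at most two. -/
open SimpleGraph

/-- The cycle graph on `ZMod n` (for `3 ≤ n` this is a cycle of length `n`). -/
def cycGraph (n : ℕ) : SimpleGraph (ZMod n) :=
  SimpleGraph.fromRel (fun x y => x = y + 1)

/-- The set `s` of nodes induces a path in the graph `H`. -/
def IsPathSet {ι : Type} (H : SimpleGraph ι) (s : Set ι) : Prop :=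
  (H.induce s).Connected ∧ ∀ x ∈ s, {y | y ∈ s ∧ H.Adj x y}.ncard ≤ 2

/-- The set `s` of nodes induces a directed path in `H` with respect to the
orientation `o` of the edges of `H`. -/
def IsDirPathSet {ι : Type} (H : SimpleGraph ι) (o : ι → ι → Prop) (s : Set ι) : Prop :=
  IsPathSet H s ∧ (∀ x ∈ s, {y | y ∈ s ∧ o x y}.ncard ≤ 1) ∧
    (∀ x ∈ s, {y | y ∈ s ∧ o y x}.ncard ≤ 1)

/-- A tree decomposition of a finite simple graph `G`. -/
structure TreeDecomp {V : Type} (G : SimpleGraph V) where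
  ι : Type
  finι : Finite ι
  tree : SimpleGraph ι
  isTree : tree.IsTree
  bag : ι → Set V
  bag_cover : ∀ v : V, ∃ x, v ∈ bag x
  bag_edge : ∀ ⦃u v : V⦄, G.Adj u v → ∃ x, u ∈ bag x ∧ v ∈ bag x
  bag_conn : ∀ v : V, (tree.induce {x | v ∈ bag x}).Connected

/-- A spaghetti tree decomposition: for every vertex `v` of `G`, the nodes whose
bags contain `v` induce a path in the tree. -/
structure SpaghettiTD {V : Type} (G : SimpleGraph V) extends TreeDecomp G where
  bag_path : ∀ v : V, IsPathSet tree {x | v ∈ bag x}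

/-- A directed spaghetti tree decomposition: the tree edges are oriented, and for
every vertex `v` of `G` the nodes whose bags contain `v` induce a directed path. -/
structure DirSpaghettiTD {V : Type} (G : SimpleGraph V) extends TreeDecomp G where
  orient : ι → ι → Prop
  orient_iff : ∀ x y : ι, tree.Adj x y ↔ (orient x y ∨ orient y x)
  orient_asymm : ∀ x y : ι, orient x y → ¬ orient y x
  bag_dirpath : ∀ v : V, IsDirPathSet tree orient {x | v ∈ bag x}

/-- A special tree decomposition: the tree is rooted, and for every vertex `v` of
`G` the nodes whose bags contain `v` induce a vertical path, i.e. a directed path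
with respect to the orientation of every tree edge towards the root. -/
structure SpecialTD {V : Type} (G : SimpleGraph V) extends TreeDecomp G where
  root : ι
  bag_vertical : ∀ v : V,
    IsDirPathSet tree (fun x y => tree.Adj x y ∧ tree.dist y root < tree.dist x root)
      {x | v ∈ bag x}

/-- A path decomposition of a finite simple graph `G`. -/
structure PathDecomp {V : Type} (G : SimpleGraph V) where
  m : ℕ
  hm : 0 < m
  bag : Fin m → Set V
  bag_cover : ∀ v : V, ∃ i, v ∈ bag i
  bag_edge : ∀ ⦃u v : V⦄, G.Adj u v → ∃ i, u ∈ bag i ∧ v ∈ bag i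
  bag_convex : ∀ (v : V) (i j k : Fin m), i ≤ j → j ≤ k → v ∈ bag i → v ∈ bag k → v ∈ bag j

/-- Treewidth: minimal width of a tree decomposition. -/
noncomputable def treewidth {V : Type} (G : SimpleGraph V) : ℕ :=
  sInf {k | ∃ td : TreeDecomp G, ∀ x, (td.bag x).ncard ≤ k + 1}

/-- Spaghetti treewidth: minimal width of a spaghetti tree decomposition. -/
noncomputable def sptw {V : Type} (G : SimpleGraph V) : ℕ :=
  sInf {k | ∃ td : SpaghettiTD G, ∀ x, (td.bag x).ncard ≤ k + 1}

/-- Directed spaghetti treewidth: minimal width of a directed spaghetti tree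
decomposition. -/
noncomputable def dptw {V : Type} (G : SimpleGraph V) : ℕ :=
  sInf {k | ∃ td : DirSpaghettiTD G, ∀ x, (td.bag x).ncard ≤ k + 1}

/-- Special treewidth: minimal width of a special tree decomposition. -/
noncomputable def spctw {V : Type} (G : SimpleGraph V) : ℕ :=
  sInf {k | ∃ td : SpecialTD G, ∀ x, (td.bag x).ncard ≤ k + 1}

/-- Pathwidth: minimal width of a path decomposition. -/
noncomputable def pw {V : Type} (G : SimpleGraph V) : ℕ :=
  sInf {k | ∃ pd : PathDecomp G, ∀ i, (pd.bag i).ncard ≤ k + 1}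

/-- A graph is chordal iff it has no induced (i.e. chordless) cycle of length at
least four. -/
def IsChordal {V : Type} (G : SimpleGraph V) : Prop :=
  ∀ (S : Set V) (n : ℕ), 4 ≤ n → ¬ Nonempty ((G.induce S) ≃g cycGraph n)

/-- A graph is strongly chordal if it is chordal and every even cycle of length at
least six has an odd chord: a chord splitting the cycle into two odd paths of
length at least three. -/
def IsStronglyChordal {V : Type} (G : SimpleGraph V) : Prop :=
  IsChordal G ∧ ∀ n : ℕ, 6 ≤ n → Even n → ∀ f : ZMod n → V,
    Function.Injective f → (∀ i : ZMod n, G.Adj (f i) (f (i + 1))) →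
      ∃ (i : ZMod n) (d : ℕ), Odd d ∧ 3 ≤ d ∧ d + 3 ≤ n ∧ G.Adj (f i) (f (i + (d : ZMod n)))

/-- Strongly chordal treewidth: the minimum of `ω(H) - 1` over all strongly chordal
supergraphs `H` of `G` (on the same vertex set; here `ω(H) ≤ k + 1` is expressed as
`H.CliqueFree (k + 2)`). -/
noncomputable def sctw {V : Type} (G : SimpleGraph V) : ℕ :=
  sInf {k | ∃ H : SimpleGraph V, G ≤ H ∧ IsStronglyChordal H ∧ H.CliqueFree (k + 2)}

/-- `H` is a minor of `G`: there is a family of nonempty, pairwise disjoint,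
connected branch sets in `G`, one for each vertex of `H`, such that every edge of
`H` is realized by an edge of `G` between the corresponding branch sets. -/
def IsMinorOf {W V : Type} (H : SimpleGraph W) (G : SimpleGraph V) : Prop :=
  ∃ f : W → Set V,
    (∀ w, (f w).Nonempty) ∧ (∀ w, (G.induce (f w)).Connected) ∧
    (Pairwise fun w w' => Disjoint (f w) (f w')) ∧
    ∀ ⦃w w'⦄, H.Adj w w' → ∃ u ∈ f w, ∃ v ∈ f w', G.Adj u v

/-- The complete graph on four vertices. -/
def K4 : SimpleGraph (Fin 4) := ⊤

/-- `D₃`: two vertices (`0` and `1`) joined by three internally vertex-disjoint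
paths of length three. -/
def D3 : SimpleGraph (Fin 8) := SimpleGraph.fromRel (fun x y =>
  (x = 0 ∧ y = 2) ∨ (x = 2 ∧ y = 3) ∨ (x = 3 ∧ y = 1) ∨
  (x = 0 ∧ y = 4) ∨ (x = 4 ∧ y = 5) ∨ (x = 5 ∧ y = 1) ∨
  (x = 0 ∧ y = 6) ∨ (x = 6 ∧ y = 7) ∨ (x = 7 ∧ y = 1))

/-- `S₃` (the 3-sun): a 6-cycle `0 1 2 3 4 5` together with the triangle `1 3 5`. -/
def S3 : SimpleGraph (Fin 6) := SimpleGraph.fromRel (fun x y =>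
  (x = 0 ∧ y = 1) ∨ (x = 1 ∧ y = 2) ∨ (x = 2 ∧ y = 3) ∨ (x = 3 ∧ y = 4) ∨
  (x = 4 ∧ y = 5) ∨ (x = 5 ∧ y = 0) ∨ (x = 1 ∧ y = 3) ∨ (x = 3 ∧ y = 5) ∨ (x = 5 ∧ y = 1))

/-- A graph is 2-connected if it has at least three vertices and deleting any one
vertex leaves it connected. -/
def TwoConnected {V : Type} (G : SimpleGraph V) : Prop :=
  3 ≤ Nat.card V ∧ ∀ v : V, (G.induce {x | x ≠ v}).Connected

/-- The cell completion of `G`: add an edge `vw` for every pair of (nonadjacent)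
vertices `v, w` such that deleting `v` and `w` leaves at least three connected
components. -/
def cellCompletion {V : Type} (G : SimpleGraph V) : SimpleGraph V :=
  SimpleGraph.fromRel (fun v w => G.Adj v w ∨
    3 ≤ Nat.card ((G.induce {x | x ≠ v ∧ x ≠ w}).ConnectedComponent))

/-- The induced subgraph of `G` on `S` has no cut vertex. -/
def NoCutVertex {V : Type} (G : SimpleGraph V) (S : Set V) : Prop :=
  ∀ v ∈ S, (S \ {v}).Nonempty → (G.induce (S \ {v})).Connected

/-- `S` carries a block of `G`: a maximal connected (induced) subgraph without a
cut vertex. -/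
def IsBlock {V : Type} (G : SimpleGraph V) (S : Set V) : Prop :=
  S.Nonempty ∧ (G.induce S).Connected ∧ NoCutVertex G S ∧
    ∀ S' : Set V, S ⊆ S' → (G.induce S').Connected → NoCutVertex G S' → S' = S

/-- Glue a cycle of length `n` onto the graph `G` by identifying the cycle edge
`{0, 1}` (with its end vertices) with the edge `{a, b}` of `G`. -/
def glueCycle {V : Type} (G : SimpleGraph V) (n : ℕ) (a b : V) :
    SimpleGraph (V ⊕ {x : ZMod n // x ≠ 0 ∧ x ≠ 1}) :=
  SimpleGraph.fromRel (fun p q =>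
    match p, q with
    | Sum.inl u, Sum.inl v => G.Adj u v
    | Sum.inl u, Sum.inr x => (u = a ∧ (cycGraph n).Adj 0 x.1) ∨ (u = b ∧ (cycGraph n).Adj 1 x.1)
    | Sum.inr x, Sum.inr y => (cycGraph n).Adj x.1 y.1
    | Sum.inr _, Sum.inl _ => False)

/-- The class of trees of cycles: every cycle is a tree of cycles, and gluing a
cycle onto a tree of cycles along an edge yields a tree of cycles (up to
isomorphism). -/
inductive IsTreeOfCycles : {V : Type} → SimpleGraph V → Prop
  | cycle {V : Type} (G : SimpleGraph V) (n : ℕ) (hn : 3 ≤ n)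
      (e : Nonempty (G ≃g cycGraph n)) : IsTreeOfCycles G
  | glue {V W : Type} (G : SimpleGraph V) (hG : IsTreeOfCycles G)
      (n : ℕ) (hn : 3 ≤ n) (a b : V) (hab : G.Adj a b)
      (H : SimpleGraph W) (e : Nonempty (H ≃g glueCycle G n a b)) : IsTreeOfCycles H

/-- `S` is the vertex set of a chordless cycle of `G`, i.e. it induces a cycle. -/
def IsChordlessCycle {V : Type} (G : SimpleGraph V) (S : Set V) : Prop :=
  ∃ n : ℕ, 3 ≤ n ∧ Nonempty ((G.induce S) ≃g cycGraph n)

/-- The edge `uv` is an edge separator: it lies in at least two distinct chordless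
cycles of `G`. -/
def IsEdgeSeparator {V : Type} (G : SimpleGraph V) (u v : V) : Prop :=
  G.Adj u v ∧ ∃ S₁ S₂ : Set V, S₁ ≠ S₂ ∧ IsChordlessCycle G S₁ ∧ IsChordlessCycle G S₂ ∧
    u ∈ S₁ ∧ v ∈ S₁ ∧ u ∈ S₂ ∧ v ∈ S₂

/-- `S` is a simplicial triangle of `G`: a chordless cycle on three vertices
containing a simplicial vertex of `G`. -/
def IsSimplicialTriangle {V : Type} (G : SimpleGraph V) (S : Set V) : Prop :=
  IsChordlessCycle G S ∧ S.ncard = 3 ∧ ∃ v ∈ S, G.IsClique (G.neighborSet v)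

/-- A chain tree of cycles: a tree of cycles in which every edge lies in at most two
chordless cycles that are not simplicial triangles (equivalently, if an edge lies in
`m ≥ 3` chordless cycles then at least `m - 2` of them are simplicial triangles). -/
def IsChainTreeOfCycles {V : Type} (G : SimpleGraph V) : Prop :=
  IsTreeOfCycles G ∧ ∀ u v : V, G.Adj u v →
    {S : Set V | IsChordlessCycle G S ∧ u ∈ S ∧ v ∈ S ∧ ¬ IsSimplicialTriangle G S}.ncard ≤ 2

/-- A tree of two-boundaried cycles: a tree of cycles in which every chordless
cycle contains at most two edge separators. -/
def IsTreeOfTwoBoundariedCycles {V : Type} (G : SimpleGraph V) : Prop :=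
  IsTreeOfCycles G ∧ ∀ S : Set V, IsChordlessCycle G S →
    {e : Sym2 V | ∃ u v : V, e = s(u, v) ∧ u ∈ S ∧ v ∈ S ∧ IsEdgeSeparator G u v}.ncard ≤ 2

/-- A path of cycles: a tree of cycles in which every chordless cycle contains at
most two edge separators and every edge lies in at most two chordless cycles that
are not simplicial triangles. -/
def IsPathOfCycles {V : Type} (G : SimpleGraph V) : Prop :=
  IsTreeOfCycles G ∧
    (∀ S : Set V, IsChordlessCycle G S →
      {e : Sym2 V | ∃ u v : V, e = s(u, v) ∧ u ∈ S ∧ v ∈ S ∧ IsEdgeSeparator G u v}.ncard ≤ 2) ∧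
    ∀ u v : V, G.Adj u v →
      {S : Set V | IsChordlessCycle G S ∧ u ∈ S ∧ v ∈ S ∧ ¬ IsSimplicialTriangle G S}.ncard ≤ 2

/-- The graph is a single edge. -/
def IsSingleEdgeGraph {V : Type} (G : SimpleGraph V) : Prop :=
  Nat.card V = 2 ∧ ∀ a b : V, a ≠ b → G.Adj a b

/-- A mamba: a 2-connected graph of pathwidth two, a single edge, or an isolated
vertex. -/
def IsMamba {V : Type} (G : SimpleGraph V) : Prop :=
  (TwoConnected G ∧ pw G = 2) ∨ IsSingleEdgeGraph G ∨ Nat.card V = 1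

/-- `v` is a head vertex of the mamba `G`: some path decomposition of `G` of width
at most two has `v` in its first bag. -/
def IsHeadVertex {V : Type} (G : SimpleGraph V) (v : V) : Prop :=
  ∃ pd : PathDecomp G, (∀ i, (pd.bag i).ncard ≤ 3) ∧ v ∈ pd.bag ⟨0, pd.hm⟩

/-- Glue the graph `M` onto the graph `G` by identifying the vertex `h` of `M` with
the vertex `x` of `G`. -/
def glueAtVertex {V W : Type} (G : SimpleGraph V) (x : V) (M : SimpleGraph W) (h : W) :
    SimpleGraph (V ⊕ {w : W // w ≠ h}) :=
  SimpleGraph.fromRel (fun p q =>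
    match p, q with
    | Sum.inl u, Sum.inl u' => G.Adj u u'
    | Sum.inl u, Sum.inr w => u = x ∧ M.Adj h w.1
    | Sum.inr w, Sum.inr w' => M.Adj w.1 w'.1
    | Sum.inr _, Sum.inl _ => False)

/-- The class of mamba trees: every mamba is a mamba tree, and gluing a mamba onto
a mamba tree by identifying a vertex of the mamba tree with a head vertex of the
mamba yields a mamba tree (up to isomorphism). -/
inductive IsMambaTree : {V : Type} → SimpleGraph V → Prop
  | mamba {V : Type} (G : SimpleGraph V) (hG : IsMamba G) : IsMambaTree G
  | glue {V W U : Type} (G : SimpleGraph V) (hG : IsMambaTree G)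
      (M : SimpleGraph W) (hM : IsMamba M) (x : V) (h : W) (hh : IsHeadVertex M h)
      (K : SimpleGraph U) (e : Nonempty (K ≃g glueAtVertex G x M h)) : IsMambaTree K

/-- Subdivide the edge `{a, b}` of `G` by a new vertex. -/
def subdivideEdge {V : Type} (G : SimpleGraph V) (a b : V) : SimpleGraph (V ⊕ Unit) :=
  SimpleGraph.fromRel (fun p q =>
    match p, q with
    | Sum.inl u, Sum.inl v => G.Adj u v ∧ ¬(u = a ∧ v = b) ∧ ¬(u = b ∧ v = a)
    | Sum.inl u, Sum.inr _ => u = a ∨ u = b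
    | Sum.inr _, _ => False)

/-- `H` is a subdivision of `G`: `H` is obtained from (an isomorphic copy of) `G`
by repeatedly subdividing edges. -/
inductive IsSubdivisionOf : {W V : Type} → SimpleGraph W → SimpleGraph V → Prop
  | base {V W : Type} {G : SimpleGraph V} {H : SimpleGraph W}
      (e : Nonempty (H ≃g G)) : IsSubdivisionOf H G
  | step {V W U : Type} {G : SimpleGraph V} {H : SimpleGraph W} (a b : W) (hab : H.Adj a b)
      (h : IsSubdivisionOf H G) {K : SimpleGraph U}
      (e : Nonempty (K ≃g subdivideEdge H a b)) : IsSubdivisionOf K G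

/-- Contract the edge `{a, b}` of `G` (the contracted vertex is `a`, `b` is removed). -/
def contractEdge {V : Type} (G : SimpleGraph V) (a b : V) : SimpleGraph {x : V // x ≠ b} :=
  SimpleGraph.fromRel (fun x y =>
    G.Adj x.1 y.1 ∨ (x.1 = a ∧ G.Adj b y.1) ∨ (y.1 = a ∧ G.Adj b x.1))

/-- The sets `A` and `B` share a vertex or are joined by an edge of `G`. -/
def Touch {V : Type} (G : SimpleGraph V) (A B : Set V) : Prop :=
  ∃ a ∈ A, ∃ b ∈ B, a = b ∨ G.Adj a b

section Touch

variable {V : Type} {G : SimpleGraph V} {A B C : Set V} {u v : V}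

theorem Touch.symm (h : Touch G A B) : Touch G B A := by
  obtain ⟨a, ha, b, hb, h⟩ := h
  exact ⟨b, hb, a, ha, h.imp Eq.symm fun h => h.symm⟩

theorem Touch.mono_left (h : Touch G A B) (hAC : A ⊆ C) : Touch G C B := by
  obtain ⟨a, ha, h⟩ := h
  exact ⟨a, hAC ha, h⟩

theorem Touch.mono_right (h : Touch G A B) (hBC : B ⊆ C) : Touch G A C :=
  (h.symm.mono_left hBC).symm

theorem touch_union_left : Touch G (A ∪ B) C ↔ Touch G A C ∨ Touch G B C := by
  constructor
  · rintro ⟨a, ha | ha, h⟩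
    · exact Or.inl ⟨a, ha, h⟩
    · exact Or.inr ⟨a, ha, h⟩
  · rintro (h | h)
    · exact h.mono_left Set.subset_union_left
    · exact h.mono_left Set.subset_union_right

theorem touch_union_right : Touch G A (B ∪ C) ↔ Touch G A B ∨ Touch G A C :=
  ⟨fun h => (touch_union_left.1 h.symm).imp Touch.symm Touch.symm, fun h =>
    (touch_union_left.2 (h.imp Touch.symm Touch.symm)).symm⟩

theorem touch_of_mem (hu : u ∈ A) (hv : v ∈ B) (h : G.Adj u v) : Touch G A B :=
  ⟨u, hu, v, hv, Or.inr h⟩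

theorem Touch.exists_adj_left (h : Touch G {u} A) (hu : u ∉ A) : ∃ a ∈ A, G.Adj u a := by
  obtain ⟨a, rfl, b, hb, rfl | h⟩ := h
  · exact absurd hb hu
  · exact ⟨b, hb, h⟩

theorem Touch.adj (h : Touch G {u} {v}) (huv : u ≠ v) : G.Adj u v := by
  obtain ⟨_, rfl, hadj⟩ := h.exists_adj_left (A := {v}) huv
  exact hadj

theorem connected_induce_singleton : (G.induce {u}).Connected := by
  have : Nonempty ({u} : Set V) := ⟨⟨u, rfl⟩⟩
  exact ⟨.of_subsingleton⟩

theorem Touch.connected_union (h : Touch G A B) (hA : (G.induce A).Connected)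
    (hB : (G.induce B).Connected) : (G.induce (A ∪ B)).Connected := by
  obtain ⟨a, ha, b, hb, rfl | h⟩ := h
  · exact induce_union_connected hA.preconnected hB.preconnected ⟨a, ha, hb⟩
  · exact connected_induce_union hA.preconnected hB.preconnected ha hb h

theorem SimpleGraph.Connected.nonempty_of_induce (hA : (G.induce A).Connected) : A.Nonempty :=
  let ⟨a⟩ := hA.nonempty
  ⟨a.1, a.2⟩

/-- A connected set of vertices with at least two elements splits into two connected parts, so
connected sets are built from singletons by disjoint touching unions. -/
theorem connected_set_induction [Finite V] {p : ∀ S : Set V, (G.induce S).Connected → Prop}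
    (single : ∀ v, p {v} connected_induce_singleton)
    (union : ∀ (P Q : Set V) (hP : (G.induce P).Connected) (hQ : (G.induce Q).Connected)
      (_ : Disjoint P Q) (hPQ : Touch G P Q), p P hP → p Q hQ →
      p (P ∪ Q) (hPQ.connected_union hP hQ))
    (S : Set V) (hS : (G.induce S).Connected) : p S hS := by
  induction hn : S.ncard using Nat.strong_induction_on generalizing S with
  | _ n ih =>
  obtain ⟨a, rfl⟩ | hnt := hS.nonempty_of_induce.exists_eq_singleton_or_nontrivial
  · exact single a
  have : Nontrivial S := hnt.coe_sort
  obtain ⟨⟨x, hx⟩, hc⟩ := hS.exists_connected_induce_compl_singleton_of_finite_nontrivial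
  have hc' : (G.induce (S \ {x})).Connected := by
    let e : (G.induce S).induce {(⟨x, hx⟩ : S)}ᶜ →g G.induce (S \ {x}) :=
      { toFun := fun y => ⟨y.1.1, y.1.2, fun h => y.2 (Subtype.ext h)⟩
        map_rel' := fun h => h }
    refine hc.map e ?_
    rintro ⟨y, hy, hyx⟩
    exact ⟨⟨⟨y, hy⟩, fun h => hyx (congrArg Subtype.val h)⟩, rfl⟩
  have hlt : (S \ {x}).ncard < n := by
    rw [← hn]
    exact Set.ncard_lt_ncard (Set.sdiff_singleton_ssubset.2 hx) (Set.toFinite _)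
  have heq : S \ {x} ∪ {x} = S := by simp [hx]
  have ht : Touch G (S \ {x}) {x} := by
    obtain ⟨z, hz⟩ := hS.preconnected.exists_adj_of_nontrivial ⟨x, hx⟩
    exact touch_of_mem ⟨z.2, fun h => hz.ne (Subtype.ext h.symm)⟩ rfl hz.symm
  have hp := union _ _ hc' connected_induce_singleton (by simp) ht (ih _ hlt _ hc' rfl) (single x)
  simpa only [heq] using hp

end Touch

/-- `G` has no induced four-cycle of pairwise touching connected sets. -/
def NoFourCycleModel {V : Type} (G : SimpleGraph V) : Prop :=
  ∀ A B C D : Set V, (G.induce A).Connected → (G.induce B).Connected → (G.induce C).Connected →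
    (G.induce D).Connected → Touch G A B → Touch G B C → Touch G C D → Touch G D A →
    Touch G A C ∨ Touch G B D

/-- `G` has no `K₄` minor model. -/
def NoK4Model {V : Type} (G : SimpleGraph V) : Prop :=
  ∀ A B C D : Set V, (G.induce A).Connected → (G.induce B).Connected → (G.induce C).Connected →
    (G.induce D).Connected → Disjoint A B → Disjoint A C → Disjoint A D → Disjoint B C →
    Disjoint B D → Disjoint C D → Touch G A B → Touch G A C → Touch G A D → Touch G B C →
    Touch G B D → Touch G C D → False

/-- `G` has no model of the 3-sun: three disjoint, pairwise touching connected sets `A`, `B`, `C`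
together with connected sets `X`, `Y`, `Z`, each avoiding `A`, `B`, `C` and touching two of them. -/
def NoSunModel {V : Type} (G : SimpleGraph V) : Prop :=
  ∀ A B C X Y Z : Set V, (G.induce A).Connected → (G.induce B).Connected →
    (G.induce C).Connected → (G.induce X).Connected → (G.induce Y).Connected →
    (G.induce Z).Connected → Disjoint A B → Disjoint A C → Disjoint B C →
    Disjoint X A → Disjoint X B → Disjoint X C → Disjoint Y A → Disjoint Y B → Disjoint Y C →
    Disjoint Z A → Disjoint Z B → Disjoint Z C → Touch G A B → Touch G A C → Touch G B C →
    Touch G X B → Touch G X C → Touch G Y A → Touch G Y C → Touch G Z A → Touch G Z B → False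

section Models

variable {V : Type} [Finite V] {G : SimpleGraph V}

/-- Helly property: a connected set touching each of a family of pairwise touching connected sets
has a vertex touching each of them. -/
theorem NoFourCycleModel.exists_touch (hG : NoFourCycleModel G) (F : Set (Set V))
    (hF : ∀ A ∈ F, (G.induce A).Connected) (hFF : ∀ A ∈ F, ∀ B ∈ F, A ≠ B → Touch G A B)
    (S : Set V) (hS : (G.induce S).Connected) (hSF : ∀ A ∈ F, Touch G S A) :
    ∃ s ∈ S, ∀ A ∈ F, Touch G {s} A := by
  induction S, hS using connected_set_induction with
  | single v => exact ⟨v, rfl, hSF⟩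
  | union P Q hP hQ _ hPQ ihP ihQ =>
    by_cases h1 : ∀ A ∈ F, Touch G P A
    · obtain ⟨s, hs, h⟩ := ihP h1
      exact ⟨s, Or.inl hs, h⟩
    by_cases h2 : ∀ A ∈ F, Touch G Q A
    · obtain ⟨s, hs, h⟩ := ihQ h2
      exact ⟨s, Or.inr hs, h⟩
    push Not at h1 h2
    obtain ⟨A, hA, hPA⟩ := h1
    obtain ⟨B, hB, hQB⟩ := h2
    have hQA := (touch_union_left.1 (hSF A hA)).resolve_left hPA
    have hPB := (touch_union_left.1 (hSF B hB)).resolve_right hQB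
    have hAB : A ≠ B := by
      rintro rfl
      exact hPA hPB
    rcases hG P B A Q hP (hF B hB) (hF A hA) hQ hPB (hFF B hB A hA hAB.symm) hQA.symm hPQ.symm
      with h | h
    · exact (hPA h).elim
    · exact (hQB h.symm).elim

/-- Two adjacent vertices touched by a connected set have a common neighbour in it. -/
theorem NoFourCycleModel.exists_common_adj (hG : NoFourCycleModel G) {u v : V} (huv : G.Adj u v)
    {S : Set V} (hS : (G.induce S).Connected) (hu : u ∉ S) (hv : v ∉ S)
    (hSu : Touch G S {u}) (hSv : Touch G S {v}) : ∃ s ∈ S, G.Adj s u ∧ G.Adj s v := by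
  have huv' : Touch G {u} {v} := touch_of_mem rfl rfl huv
  obtain ⟨s, hs, h⟩ := hG.exists_touch {{u}, {v}}
    (by rintro A (rfl | rfl) <;> exact connected_induce_singleton)
    (by
      rintro A (rfl | rfl) B (rfl | rfl) hAB
      exacts [(hAB rfl).elim, huv', huv'.symm, (hAB rfl).elim])
    S hS (by rintro A (rfl | rfl) <;> assumption)
  refine ⟨s, hs, (h _ (Or.inl rfl)).adj ?_, (h _ (Or.inr rfl)).adj ?_⟩
  · rintro rfl
    exact hu hs
  · rintro rfl
    exact hv hs

/-- A connected set touching a connected set `B` grows inside `B \ {b}` until it touches `b`. -/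
theorem exists_connected_touch_singleton (B : Set V) (hB : (G.induce B).Connected) (b : V)
    (hb : b ∈ B) (Y : Set V) (hY : (G.induce Y).Connected) (hYB : Touch G Y B)
    (hbY : b ∉ Y) : ∃ Y' : Set V, (G.induce Y').Connected ∧ Y ⊆ Y' ∧ Y' ⊆ Y ∪ B ∧ b ∉ Y' ∧
      Touch G Y' {b} := by
  induction B, hB using connected_set_induction generalizing Y with
  | single v =>
    obtain rfl : b = v := hb
    exact ⟨Y, hY, subset_rfl, Set.subset_union_left, hbY, hYB⟩
  | union P Q hP hQ hd hPQ ihP ihQ =>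
    have key : ∀ P Q : Set V, (G.induce Q).Connected → Disjoint P Q → Touch G P Q →
        (∀ (_ : b ∈ P) (Y : Set V), (G.induce Y).Connected → Touch G Y P → b ∉ Y →
          ∃ Y' : Set V, (G.induce Y').Connected ∧ Y ⊆ Y' ∧ Y' ⊆ Y ∪ P ∧ b ∉ Y' ∧
            Touch G Y' {b}) → b ∈ P → Touch G Y (P ∪ Q) →
        ∃ Y' : Set V, (G.induce Y').Connected ∧ Y ⊆ Y' ∧ Y' ⊆ Y ∪ (P ∪ Q) ∧ b ∉ Y' ∧
          Touch G Y' {b} := by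
      intro P Q hQ hd hPQ ih hbP ht
      rcases touch_union_right.1 ht with h | h
      · obtain ⟨Y', h1, h2, h3, h4⟩ := ih hbP Y hY h hbY
        exact ⟨Y', h1, h2, h3.trans (by grind), h4⟩
      · obtain ⟨Y', h1, h2, h3, h4⟩ := ih hbP (Y ∪ Q) (h.connected_union hY hQ)
          (touch_union_left.2 (Or.inr hPQ.symm))
          (fun h => h.elim hbY (Set.disjoint_left.1 hd hbP))
        exact ⟨Y', h1, Set.subset_union_left.trans h2, h3.trans (by grind), h4⟩
    rcases hb with hb | hb
    · exact key P Q hQ hd hPQ ihP hb hYB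
    · rw [Set.union_comm P Q] at hYB ⊢
      exact key Q P hP hd.symm hPQ.symm ihQ hb hYB

/-- A connected set touching `B ∋ b` and `C ∋ c` yields a common neighbour of the adjacent vertices
`b` and `c` in the union of the three sets. -/
theorem NoFourCycleModel.exists_apex (hG : NoFourCycleModel G) {B C Y : Set V} {b c : V}
    (hB : (G.induce B).Connected) (hC : (G.induce C).Connected) (hY : (G.induce Y).Connected)
    (hBC : Disjoint B C) (hYB : Disjoint Y B) (hYC : Disjoint Y C) (hb : b ∈ B) (hc : c ∈ C)
    (hbc : G.Adj b c) (htB : Touch G Y B) (htC : Touch G Y C) :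
    ∃ y ∈ Y ∪ B ∪ C, G.Adj y b ∧ G.Adj y c := by
  obtain ⟨Y₁, h1, h2, h3, h4, h5⟩ := exists_connected_touch_singleton B hB b hb Y hY htB
    (Set.disjoint_right.1 hYB hb)
  have hc1 : c ∉ Y₁ := fun h =>
    (h3 h).elim (Set.disjoint_right.1 hYC hc) (Set.disjoint_right.1 hBC hc)
  obtain ⟨Y₂, k1, k2, k3, k4, k5⟩ := exists_connected_touch_singleton C hC c hc Y₁ h1
    (htC.mono_left h2) hc1
  have hb2 : b ∉ Y₂ := fun h => (k3 h).elim h4 (Set.disjoint_left.1 hBC hb)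
  obtain ⟨y, hy, h⟩ := hG.exists_common_adj hbc k1 hb2 k4 (h5.mono_left k2) k5
  exact ⟨y, (k3 hy).imp (fun h => h3 h) id, h⟩

/-- Three disjoint pairwise touching connected sets have a transversal triangle. -/
theorem NoFourCycleModel.exists_triangle (hG : NoFourCycleModel G) {A B C : Set V}
    (hA : (G.induce A).Connected) (hB : (G.induce B).Connected) (hC : (G.induce C).Connected)
    (hAB : Disjoint A B) (hAC : Disjoint A C) (hBC : Disjoint B C)
    (tAB : Touch G A B) (tAC : Touch G A C) (tBC : Touch G B C) :
    ∃ a ∈ A, ∃ b ∈ B, ∃ c ∈ C, G.Adj a b ∧ G.Adj a c ∧ G.Adj b c := by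
  obtain ⟨a, ha, h⟩ := hG.exists_touch {B, C} (by rintro S (rfl | rfl) <;> assumption)
    (by
      rintro S (rfl | rfl) T (rfl | rfl) hST
      exacts [(hST rfl).elim, tBC, tBC.symm, (hST rfl).elim])
    A hA (by rintro S (rfl | rfl) <;> assumption)
  have haB := h _ (Or.inl rfl)
  have haC := h _ (Or.inr rfl)
  obtain ⟨b, hb, h⟩ := hG.exists_touch {{a}, C}
    (by rintro S (rfl | rfl); exacts [connected_induce_singleton, hC])
    (by
      rintro S (rfl | rfl) T (rfl | rfl) hST
      exacts [(hST rfl).elim, haC, haC.symm, (hST rfl).elim])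
    B hB (by rintro S (rfl | rfl); exacts [haB.symm, tBC])
  have hab := (h _ (Or.inl rfl)).adj (by rintro rfl; exact Set.disjoint_left.1 hAB ha hb)
  obtain ⟨c, hc, h1, h2⟩ := hG.exists_common_adj hab hC (Set.disjoint_left.1 hBC hb)
    (Set.disjoint_left.1 hAC ha) (h _ (Or.inr rfl)).symm haC.symm
  exact ⟨a, ha, b, hb, c, hc, hab.symm, h2.symm, h1.symm⟩

theorem not_cliqueFree_four {V : Type} {G : SimpleGraph V} {a b c d : V} (hab : G.Adj a b)
    (hac : G.Adj a c) (had : G.Adj a d) (hbc : G.Adj b c) (hbd : G.Adj b d) (hcd : G.Adj c d) :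
    ¬ G.CliqueFree 4 := by
  classical
  intro h
  have h3 : G.IsNClique 3 {b, c, d} := is3Clique_triple_iff.2 ⟨hbc, hbd, hcd⟩
  refine h _ (h3.insert (a := a) ?_)
  simp [hab, hac, had]

theorem NoFourCycleModel.noK4Model (hG : NoFourCycleModel G) (hK : G.CliqueFree 4) :
    NoK4Model G := by
  intro A B C D hA hB hC hD dAB dAC dAD dBC dBD dCD tAB tAC tAD tBC tBD tCD
  obtain ⟨a, ha, h⟩ := hG.exists_touch {B, C, D} (by rintro S (rfl | rfl | rfl) <;> assumption)
    (by
      rintro S (rfl | rfl | rfl) T (rfl | rfl | rfl) hST <;>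
        first | exact (hST rfl).elim | assumption | (apply Touch.symm; assumption))
    A hA (by rintro S (rfl | rfl | rfl) <;> assumption)
  have haB := h B (by simp)
  have haC := h C (by simp)
  have haD := h D (by simp)
  have ha' : (G.induce {a}).Connected := connected_induce_singleton
  obtain ⟨b, hb, h⟩ := hG.exists_touch {{a}, C, D}
    (by rintro S (rfl | rfl | rfl) <;> assumption)
    (by
      rintro S (rfl | rfl | rfl) T (rfl | rfl | rfl) hST <;>
        first | exact (hST rfl).elim | assumption | (apply Touch.symm; assumption))
    B hB (by rintro S (rfl | rfl | rfl); exacts [haB.symm, tBC, tBD])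
  have hba := h {a} (by simp)
  have hbC := h C (by simp)
  have hbD := h D (by simp)
  have hb' : (G.induce {b}).Connected := connected_induce_singleton
  obtain ⟨c, hc, h⟩ := hG.exists_touch {{a}, {b}, D}
    (by rintro S (rfl | rfl | rfl) <;> assumption)
    (by
      rintro S (rfl | rfl | rfl) T (rfl | rfl | rfl) hST <;>
        first | exact (hST rfl).elim | assumption | (apply Touch.symm; assumption))
    C hC (by rintro S (rfl | rfl | rfl); exacts [haC.symm, hbC.symm, tCD])
  have hca := h {a} (by simp)
  have hcb := h {b} (by simp)
  have hcD := h D (by simp)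
  have hc' : (G.induce {c}).Connected := connected_induce_singleton
  obtain ⟨d, hd, h⟩ := hG.exists_touch {{a}, {b}, {c}}
    (by rintro S (rfl | rfl | rfl) <;> assumption)
    (by
      rintro S (rfl | rfl | rfl) T (rfl | rfl | rfl) hST <;>
        first | exact (hST rfl).elim | assumption | (apply Touch.symm; assumption))
    D hD (by rintro S (rfl | rfl | rfl); exacts [haD.symm, hbD.symm, hcD.symm])
  have hda := h {a} (by simp)
  have hdb := h {b} (by simp)
  have hdc := h {c} (by simp)
  exact not_cliqueFree_four (hba.symm.adj (dAB.ne_of_mem ha hb))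
    (hca.symm.adj (dAC.ne_of_mem ha hc)) (hda.symm.adj (dAD.ne_of_mem ha hd))
    (hcb.symm.adj (dBC.ne_of_mem hb hc)) (hdb.symm.adj (dBD.ne_of_mem hb hd))
    (hdc.symm.adj (dCD.ne_of_mem hc hd)) hK

theorem NoK4Model.cliqueFree {V : Type} {G : SimpleGraph V} (hG : NoK4Model G) :
    G.CliqueFree 4 := by
  intro s hs
  obtain ⟨f⟩ := (not_cliqueFree_iff_top_isContained 4).1 fun h => h s hs
  have adj : ∀ i j : Fin 4, i ≠ j → G.Adj (f i) (f j) := fun i j h => f.toHom.map_adj h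
  have dis : ∀ i j : Fin 4, i ≠ j → Disjoint ({f i} : Set V) {f j} := fun i j h => by
    simpa using (adj i j h).ne
  have tou : ∀ i j : Fin 4, i ≠ j → Touch G {f i} {f j} := fun i j h =>
    touch_of_mem rfl rfl (adj i j h)
  have con : ∀ i : Fin 4, (G.induce {f i}).Connected := fun _ => connected_induce_singleton
  exact hG {f 0} {f 1} {f 2} {f 3} (con 0) (con 1) (con 2) (con 3)
    (dis 0 1 (by decide)) (dis 0 2 (by decide)) (dis 0 3 (by decide)) (dis 1 2 (by decide))
    (dis 1 3 (by decide)) (dis 2 3 (by decide)) (tou 0 1 (by decide)) (tou 0 2 (by decide))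
    (tou 0 3 (by decide)) (tou 1 2 (by decide)) (tou 1 3 (by decide)) (tou 2 3 (by decide))

end Models

section Chordal

variable {V : Type} {G : SimpleGraph V}

theorem ZMod.val_add_one_eq_ite {n : ℕ} (hn : 2 ≤ n) (x : ZMod n) :
    (x + 1).val = if x.val + 1 = n then 0 else x.val + 1 := by
  have : NeZero n := ⟨by omega⟩
  have : Fact (1 < n) := ⟨hn⟩
  have hx := ZMod.val_lt x
  rw [ZMod.val_add, ZMod.val_one]
  split_ifs with h
  · rw [h, Nat.mod_self]
  · exact Nat.mod_eq_of_lt (by omega)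

theorem cycGraph_adj_iff_val {n : ℕ} (hn : 3 ≤ n) {x y : ZMod n} (hxy : x.val < y.val) :
    (cycGraph n).Adj x y ↔ y.val = x.val + 1 ∨ (x.val = 0 ∧ y.val + 1 = n) := by
  have : NeZero n := ⟨by omega⟩
  have hne : x ≠ y := by
    rintro rfl
    omega
  have hy := ZMod.val_lt y
  simp only [cycGraph, fromRel_adj, hne, ne_eq, not_false_eq_true, true_and,
    ← (ZMod.val_injective n).eq_iff, ZMod.val_add_one_eq_ite (by omega : 2 ≤ n)]
  split_ifs <;> omega

/-- The first `n` values of `c` are the consecutive vertices of an induced cycle. -/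
def IsHole (G : SimpleGraph V) (n : ℕ) (c : ℕ → V) : Prop :=
  ∀ i j, i < j → j < n → c i ≠ c j ∧ (G.Adj (c i) (c j) ↔ j = i + 1 ∨ (i = 0 ∧ j + 1 = n))

theorem isChordal_iff_not_isHole : IsChordal G ↔ ∀ n, 4 ≤ n → ∀ c, ¬ IsHole G n c := by
  constructor
  · intro h n hn c hc
    have : NeZero n := ⟨by omega⟩
    have hinj : Function.Injective fun x : ZMod n => c x.val := by
      intro x y hxy
      by_contra hne
      rcases lt_or_gt_of_ne fun h => hne (ZMod.val_injective n h) with h | h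
      · exact (hc _ _ h (ZMod.val_lt y)).1 hxy
      · exact (hc _ _ h (ZMod.val_lt x)).1 hxy.symm
    refine h (Set.range fun x : ZMod n => c x.val) n hn
      ⟨RelIso.symm ⟨Equiv.ofInjective _ hinj, ?_⟩⟩
    intro x y
    change G.Adj (c x.val) (c y.val) ↔ _
    rcases lt_trichotomy x.val y.val with h | h | h
    · rw [(hc _ _ h (ZMod.val_lt y)).2, cycGraph_adj_iff_val (by omega) h]
    · simp [ZMod.val_injective n h]
    · rw [G.adj_comm, SimpleGraph.adj_comm (cycGraph n), (hc _ _ h (ZMod.val_lt x)).2,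
        cycGraph_adj_iff_val (by omega) h]
  · rintro h S n hn ⟨e⟩
    have : NeZero n := ⟨by omega⟩
    refine h n hn (fun i => (e.symm (i : ZMod n)).1) fun i j hij hj => ?_
    have hvi : (i : ZMod n).val = i := ZMod.val_cast_of_lt (by omega)
    have hvj : (j : ZMod n).val = j := ZMod.val_cast_of_lt hj
    constructor
    · intro heq
      have := congrArg ZMod.val (e.symm.injective (Subtype.ext heq))
      omega
    · change (G.induce S).Adj _ _ ↔ _
      rw [e.symm.map_adj_iff, cycGraph_adj_iff_val (by omega) (by omega), hvi, hvj]

theorem connected_induce_image_Icc {c : ℕ → V} {a b : ℕ} (hab : a ≤ b)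
    (hc : ∀ i, a ≤ i → i < b → G.Adj (c i) (c (i + 1))) :
    (G.induce (c '' Set.Icc a b)).Connected := by
  induction b, hab using Nat.le_induction with
  | base =>
    rw [Set.Icc_self, Set.image_singleton]
    exact connected_induce_singleton
  | succ b hb ih =>
    have heq : c '' Set.Icc a (b + 1) = c '' Set.Icc a b ∪ {c (b + 1)} := by
      rw [← Set.image_singleton, ← Set.image_union]
      congr 1
      ext i
      simp only [Set.mem_Icc, Set.mem_union, Set.mem_singleton_iff]
      omega
    rw [heq]
    have ht : Touch G (c '' Set.Icc a b) {c (b + 1)} :=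
      touch_of_mem ⟨b, ⟨hb, le_rfl⟩, rfl⟩ rfl (hc b hb (by omega))
    exact ht.connected_union
      (ih fun i h1 h2 => hc i h1 (by omega)) connected_induce_singleton

/-- Two nonadjacent vertices touching a connected set are joined by an induced path through it. -/
theorem exists_induced_path {S : Set V} (hS : (G.induce S).Connected) {u v : V} (huv : u ≠ v)
    (hadj : ¬ G.Adj u v) (hu : u ∉ S) (hv : v ∉ S) (hSu : Touch G {u} S) (hSv : Touch G {v} S) :
    ∃ k, 2 ≤ k ∧ ∃ p : ℕ → V, p 0 = u ∧ p k = v ∧ (∀ i, 0 < i → i < k → p i ∈ S) ∧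
      ∀ i j, i < j → j ≤ k → p i ≠ p j ∧ (G.Adj (p i) (p j) ↔ j = i + 1) := by
  let R : ℕ → Prop := fun k => ∃ p : ℕ → V, p 0 = u ∧ p k = v ∧ (∀ i, 0 < i → i < k → p i ∈ S) ∧
    ∀ i, i < k → G.Adj (p i) (p (i + 1))
  have hex : ∃ k, R k := by
    obtain ⟨a, ha, hua⟩ := hSu.exists_adj_left hu
    obtain ⟨b, hb, hvb⟩ := hSv.exists_adj_left hv
    obtain ⟨w⟩ := hS.preconnected ⟨a, ha⟩ ⟨b, hb⟩
    refine ⟨w.length + 2, fun i => if i = 0 then u else if i ≤ w.length + 1 then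
      (w.getVert (i - 1)).1 else v, by simp, by simp, ?_, ?_⟩
    · intro i h1 h2
      dsimp only
      rw [if_neg (by omega), if_pos (by omega)]
      exact (w.getVert (i - 1)).2
    · intro i hi
      dsimp only
      rcases Nat.eq_zero_or_pos i with rfl | h0
      · simpa using hua
      · rcases Nat.lt_or_ge i (w.length + 1) with h | h
        · rw [if_neg (by omega), if_pos (by omega), if_neg (by omega), if_pos (by omega)]
          have := w.adj_getVert_succ (i := i - 1) (by omega)
          rw [Nat.sub_add_cancel h0] at this
          exact this
        · obtain rfl : i = w.length + 1 := by omega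
          simpa using hvb.symm
  classical
  obtain ⟨p, h0, hk, hpS, hp⟩ := Nat.find_spec hex
  have hmin : ∀ m, m < Nat.find hex → ¬ R m := fun m hm => Nat.find_min hex hm
  set k := Nat.find hex
  have hk2 : 2 ≤ k := by
    by_contra! hlt
    interval_cases k
    · exact huv (h0.symm.trans hk)
    · apply hadj
      have := hp 0 (by omega)
      rwa [h0, zero_add, hk] at this
  have shortcut : ∀ i d, 0 < d → i + d < k → ¬ G.Adj (p i) (p (i + 1 + d)) := by
    intro i d hd hid h
    refine hmin (k - d) (by omega) ⟨fun t => if t ≤ i then p t else p (t + d), by simp [h0], ?_, ?_,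
      ?_⟩
    · dsimp only
      rw [if_neg (by omega), Nat.sub_add_cancel (by omega), hk]
    · intro t ht1 ht2
      dsimp only
      split_ifs
      · exact hpS t ht1 (by omega)
      · exact hpS _ (by omega) (by omega)
    · intro t ht
      dsimp only
      rcases lt_trichotomy t i with h' | rfl | h'
      · rw [if_pos (by omega), if_pos (by omega)]
        exact hp t (by omega)
      · rwa [if_pos le_rfl, if_neg (by omega)]
      · rw [if_neg (by omega), if_neg (by omega), Nat.add_right_comm]
        exact hp _ (by omega)
  refine ⟨k, hk2, p, h0, hk, hpS, fun i j hij hj => ⟨?_, ?_⟩⟩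
  · intro heq
    rcases Nat.lt_or_ge j k with hjk | hjk
    · obtain ⟨d, rfl⟩ := Nat.exists_eq_add_of_lt hij
      refine shortcut i (d + 1) (by omega) (by omega) ?_
      rw [heq, show i + 1 + (d + 1) = i + d + 1 + 1 by omega]
      exact hp _ hjk
    · obtain rfl : j = k := by omega
      rcases Nat.eq_zero_or_pos i with rfl | h
      · exact huv (h0.symm.trans (heq.trans hk))
      · rw [hk] at heq
        exact hv (heq ▸ hpS i h hij)
  · constructor
    · intro h
      by_contra hne
      refine shortcut i (j - i - 1) (by omega) (by omega) ?_
      rwa [show i + 1 + (j - i - 1) = j by omega]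
    · rintro rfl
      exact hp i (by omega)

/-- In a chordal graph the common neighbours of two connected sets that do not touch form a
clique. -/
theorem IsChordal.adj_of_touch (hG : IsChordal G) {A S : Set V} (hA : (G.induce A).Connected)
    (hS : (G.induce S).Connected) (hAS : ¬ Touch G A S) {u v : V} (huv : u ≠ v)
    (huA : Touch G {u} A) (huS : Touch G {u} S) (hvA : Touch G {v} A) (hvS : Touch G {v} S) :
    G.Adj u v := by
  by_contra hadj
  have hu : u ∉ A := fun h => hAS (huS.mono_left (by simpa using h))
  have hu' : u ∉ S := fun h => hAS (huA.symm.mono_right (by simpa using h))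
  have hv : v ∉ A := fun h => hAS (hvS.mono_left (by simpa using h))
  have hv' : v ∉ S := fun h => hAS (hvA.symm.mono_right (by simpa using h))
  obtain ⟨k, hk, p, p0, pk, pA, hp⟩ := exists_induced_path hA huv hadj hu hv huA hvA
  obtain ⟨l, hl, q, q0, ql, qS, hq⟩ := exists_induced_path hS huv hadj hu' hv' huS hvS
  refine isChordal_iff_not_isHole.1 hG (k + l) (by omega)
    (fun i => if i ≤ k then p i else q (k + l - i)) ?_
  intro i j hij hj
  dsimp only
  rcases Nat.lt_or_ge k i with hi | hi
  · rw [if_neg (by omega), if_neg (by omega)]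
    obtain ⟨h1, h2⟩ := hq (k + l - j) (k + l - i) (by omega) (by omega)
    refine ⟨h1.symm, ?_⟩
    rw [G.adj_comm, h2]
    omega
  rcases Nat.lt_or_ge k j with hj' | hj'
  · rw [if_pos hi, if_neg (by omega)]
    have hqS := qS (k + l - j) (by omega) (by omega)
    rcases Nat.eq_zero_or_pos i with rfl | hi0
    · obtain ⟨h1, h2⟩ := hq 0 (k + l - j) (by omega) (by omega)
      rw [p0, ← q0]
      refine ⟨h1, ?_⟩
      rw [h2]
      omega
    · rcases Nat.lt_or_ge i k with hik | hik
      · have hpA := pA i hi0 hik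
        refine ⟨fun h => hAS ⟨_, hpA, _, hqS, Or.inl h⟩, fun h => ?_, fun h => by omega⟩
        exact (hAS ⟨_, hpA, _, hqS, Or.inr h⟩).elim
      · obtain rfl : i = k := by omega
        obtain ⟨h1, h2⟩ := hq (i + l - j) l (by omega) (by omega)
        rw [pk, ← ql]
        refine ⟨h1.symm, ?_⟩
        rw [G.adj_comm, h2]
        omega
  · rw [if_pos hi, if_pos hj']
    obtain ⟨h1, h2⟩ := hp i j hij hj'
    refine ⟨h1, ?_⟩
    rw [h2]
    omega

/-- To show that connected sets `U` touching two non-touching connected sets also touch `T`, it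
suffices to treat singletons. -/
theorem touch_of_forall_singleton_touch [Finite V] {T : Set V}
    (h : ∀ u : V, ∀ A S : Set V, (G.induce A).Connected → (G.induce S).Connected →
      ¬ Touch G A S → Touch G {u} A → Touch G {u} S → Touch G T A → Touch G T S → Touch G {u} T)
    (U : Set V) (hU : (G.induce U).Connected) (A S : Set V) (hA : (G.induce A).Connected)
    (hS : (G.induce S).Connected) (hAS : ¬ Touch G A S) (hUA : Touch G U A) (hUS : Touch G U S)
    (hTA : Touch G T A) (hTS : Touch G T S) : Touch G U T := by
  induction U, hU using connected_set_induction generalizing A S with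
  | single v => exact h v A S hA hS hAS hUA hUS hTA hTS
  | union P Q hP hQ _ hPQ ihP ihQ =>
    rw [touch_union_left] at hUA hUS ⊢
    by_cases hPA : Touch G P A
    · by_cases hPS : Touch G P S
      · exact Or.inl (ihP A S hA hS hAS hPA hPS hTA hTS)
      · refine Or.inr (ihQ (A ∪ P) S (hPA.symm.connected_union hA hP) hS ?_
          (touch_union_right.2 (Or.inr hPQ.symm)) (hUS.resolve_left hPS)
          (touch_union_right.2 (Or.inl hTA)) hTS)
        rw [touch_union_left]
        tauto
    · have hQA := hUA.resolve_left hPA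
      by_cases hQS : Touch G Q S
      · exact Or.inr (ihQ A S hA hS hAS hQA hQS hTA hTS)
      · refine Or.inl (ihP (A ∪ Q) S (hQA.symm.connected_union hA hQ) hS ?_
          (touch_union_right.2 (Or.inr hPQ)) (hUS.resolve_right hQS)
          (touch_union_right.2 (Or.inl hTA)) hTS)
        rw [touch_union_left]
        tauto

theorem IsChordal.noFourCycleModel [Finite V] (hG : IsChordal G) : NoFourCycleModel G := by
  intro A B C D hA hB hC hD hAB hBC hCD hDA
  by_contra! hno
  refine hno.2 (touch_of_forall_singleton_touch ?_ B hB A C hA hC hno.1 hAB.symm hBC hDA hCD.symm)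
  intro u A C hA hC hAC huA huC hDA hDC
  refine (touch_of_forall_singleton_touch ?_ D hD A C hA hC hAC hDA hDC huA huC).symm
  intro v A C hA hC hAC hvA hvC huA huC
  by_cases huv : v = u
  · exact ⟨v, rfl, u, rfl, Or.inl huv⟩
  · exact touch_of_mem rfl rfl (hG.adj_of_touch hA hC hAC huv hvA hvC huA huC)

theorem NoFourCycleModel.isChordal (hG : NoFourCycleModel G) : IsChordal G := by
  refine isChordal_iff_not_isHole.2 fun n hn c hc => ?_
  have adj : ∀ i, i + 1 < n → G.Adj (c i) (c (i + 1)) := fun i hi =>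
    (hc i (i + 1) (by omega) hi).2.2 (Or.inl rfl)
  have hlast : G.Adj (c 0) (c (n - 1)) :=
    (hc 0 (n - 1) (by omega) (by omega)).2.2 (Or.inr ⟨rfl, by omega⟩)
  have hmem : ∀ i, 2 ≤ i → i ≤ n - 2 → c i ∈ c '' Set.Icc 2 (n - 2) := fun i h1 h2 =>
    ⟨i, ⟨h1, h2⟩, rfl⟩
  rcases hG {c 0} {c 1} (c '' Set.Icc 2 (n - 2)) {c (n - 1)} connected_induce_singleton
    connected_induce_singleton
    (connected_induce_image_Icc (by omega) fun i _ h => adj i (by omega))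
    connected_induce_singleton (touch_of_mem rfl rfl (adj 0 (by omega)))
    (touch_of_mem rfl (hmem 2 le_rfl (by omega)) (adj 1 (by omega)))
    (touch_of_mem (hmem (n - 2) (by omega) le_rfl) rfl (by
      have := adj (n - 2) (by omega)
      rwa [show n - 2 + 1 = n - 1 by omega] at this))
    (touch_of_mem rfl rfl hlast.symm) with h | h
  · obtain ⟨_, rfl, _, ⟨i, ⟨hi1, hi2⟩, rfl⟩, h⟩ := h
    obtain ⟨h1, h2⟩ := hc 0 i (by omega) (by omega)
    rw [h2] at h
    rcases h with h | h
    · exact h1 h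
    · omega
  · obtain ⟨h1, h2⟩ := hc 1 (n - 1) (by omega) (by omega)
    have := h2.1 (h.adj h1)
    omega

end Chordal

section StronglyChordal

variable {V : Type} {G : SimpleGraph V}

theorem NoFourCycleModel.noSunModel [Finite V] (hG : NoFourCycleModel G)
    (hS : IsStronglyChordal G) (hK : G.CliqueFree 4) : NoSunModel G := by
  intro A B C X Y Z hA hB hC hX hY hZ dAB dAC dBC dXA dXB dXC dYA dYB dYC dZA dZB dZC tAB tAC tBC
    tXB tXC tYA tYC tZA tZB
  obtain ⟨a, ha, b, hb, c, hc, hab, hac, hbc⟩ :=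
    hG.exists_triangle hA hB hC dAB dAC dBC tAB tAC tBC
  obtain ⟨x, hx, hxb, hxc⟩ := hG.exists_apex hB hC hX dBC dXB dXC hb hc hbc tXB tXC
  obtain ⟨y, hy, hya, hyc⟩ := hG.exists_apex hA hC hY dAC dYA dYC ha hc hac tYA tYC
  obtain ⟨z, hz, hza, hzb⟩ := hG.exists_apex hA hB hZ dAB dZA dZB ha hb hab tZA tZB
  have hxa : x ≠ a := by
    rintro rfl
    rcases hx with (h | h) | h
    exacts [Set.disjoint_left.1 dXA h ha, Set.disjoint_left.1 dAB ha h,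
      Set.disjoint_left.1 dAC ha h]
  have hyb : y ≠ b := by
    rintro rfl
    rcases hy with (h | h) | h
    exacts [Set.disjoint_left.1 dYB h hb, Set.disjoint_left.1 dAB h hb,
      Set.disjoint_left.1 dBC hb h]
  have hzc : z ≠ c := by
    rintro rfl
    rcases hz with (h | h) | h
    exacts [Set.disjoint_left.1 dZC h hc, Set.disjoint_left.1 dAC h hc,
      Set.disjoint_left.1 dBC h hc]
  have nxa : ¬ G.Adj x a := fun h => not_cliqueFree_four h hxb hxc hab hac hbc hK
  have nyb : ¬ G.Adj y b := fun h => not_cliqueFree_four hya h hyc hab hac hbc hK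
  have nzc : ¬ G.Adj z c := fun h => not_cliqueFree_four hza hzb h hab hac hbc hK
  have hxy : x ≠ y := by rintro rfl; exact nxa hya
  have hxz : x ≠ z := by rintro rfl; exact nxa hza
  have hyz : y ≠ z := by rintro rfl; exact nyb hzb
  let f : ZMod 6 → V := ![a, z, b, x, c, y]
  have hinj : Function.Injective f := by
    intro i j hij
    fin_cases i <;> fin_cases j <;>
      first
      | rfl
      | exact absurd hij (by simp [f, hxa, hyb, hzc, hxy, hxz, hyz, hxa.symm, hyb.symm, hzc.symm,
          hxy.symm, hxz.symm, hyz.symm, hab.ne, hac.ne, hbc.ne, hab.ne', hac.ne', hbc.ne',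
          hxb.ne, hxb.ne', hxc.ne, hxc.ne', hya.ne, hya.ne', hyc.ne, hyc.ne', hza.ne, hza.ne',
          hzb.ne, hzb.ne'])
  have hcyc : ∀ i : ZMod 6, G.Adj (f i) (f (i + 1)) := by
    intro i
    fin_cases i
    exacts [hza.symm, hzb, hxb.symm, hxc, hyc.symm, hya]
  obtain ⟨i, d, hd, hd3, hd6, h⟩ := hS.2 6 le_rfl (by decide) f hinj hcyc
  obtain rfl : d = 3 := by omega
  fin_cases i
  exacts [nxa h.symm, nzc h, nyb h.symm, nxa h, nzc h.symm, nyb h]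

/-- `c` lists the vertices of a cycle of length `n`, followed by its first vertex. -/
structure IsCycleSeq (G : SimpleGraph V) (n : ℕ) (c : ℕ → V) : Prop where
  ne : ∀ i j, i < j → j < n → c i ≠ c j
  adj : ∀ i, G.Adj (c i) (c (i + 1))
  closed : c n = c 0

namespace IsCycleSeq

variable {n : ℕ} {c : ℕ → V}

theorem disjoint_image_Icc (hc : IsCycleSeq G n c) {a b a' b' : ℕ} (h : b < a' ∨ b' < a)
    (hb : b < n) (hb' : b' < n) : Disjoint (c '' Set.Icc a b) (c '' Set.Icc a' b') := by
  rw [Set.disjoint_left]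
  rintro _ ⟨i, ⟨hi1, hi2⟩, rfl⟩ ⟨j, ⟨hj1, hj2⟩, hij⟩
  rcases h with h | h
  · exact hc.ne i j (by omega) (by omega) hij.symm
  · exact hc.ne j i (by omega) (by omega) hij

theorem connected_image_Icc (hc : IsCycleSeq G n c) {a b : ℕ} (hab : a ≤ b) :
    (G.induce (c '' Set.Icc a b)).Connected :=
  connected_induce_image_Icc hab fun i _ _ => hc.adj i

theorem touch_image_Icc {a b a' b' i j : ℕ} (h : G.Adj (c i) (c j)) (hi : a ≤ i ∧ i ≤ b)
    (hj : a' ≤ j ∧ j ≤ b') : Touch G (c '' Set.Icc a b) (c '' Set.Icc a' b') :=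
  touch_of_mem ⟨i, hi, rfl⟩ ⟨j, hj, rfl⟩ h

theorem adj_last (hc : IsCycleSeq G n c) (hn : 0 < n) : G.Adj (c (n - 1)) (c 0) := by
  have := hc.adj (n - 1)
  rwa [Nat.sub_add_cancel hn, hc.closed] at this

theorem not_adj_and_adj (hc : IsCycleSeq G n c) (hG : NoK4Model G) (hn : 4 ≤ n)
    (h02 : G.Adj (c 0) (c 2)) (h13 : G.Adj (c 1) (c 3)) : False :=
  hG (c '' Set.Icc 0 0) (c '' Set.Icc 1 1) (c '' Set.Icc 2 2) (c '' Set.Icc 3 (n - 1))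
    (hc.connected_image_Icc le_rfl) (hc.connected_image_Icc le_rfl)
    (hc.connected_image_Icc le_rfl) (hc.connected_image_Icc (by omega))
    (hc.disjoint_image_Icc (by omega) (by omega) (by omega))
    (hc.disjoint_image_Icc (by omega) (by omega) (by omega))
    (hc.disjoint_image_Icc (by omega) (by omega) (by omega))
    (hc.disjoint_image_Icc (by omega) (by omega) (by omega))
    (hc.disjoint_image_Icc (by omega) (by omega) (by omega))
    (hc.disjoint_image_Icc (by omega) (by omega) (by omega))
    (touch_image_Icc (hc.adj 0) (by omega) (by omega))
    (touch_image_Icc h02 (by omega) (by omega))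
    (touch_image_Icc (hc.adj_last (by omega)).symm (by omega) (by omega))
    (touch_image_Icc (hc.adj 1) (by omega) (by omega))
    (touch_image_Icc h13 (by omega) (by omega))
    (touch_image_Icc (hc.adj 2) (by omega) (by omega))

theorem false_of_noSunModel (hc : IsCycleSeq G n c) (hG : NoSunModel G) (hn : 6 ≤ n)
    (h02 : G.Adj (c 0) (c 2)) (h24 : G.Adj (c 2) (c 4)) (hl : G.Adj (c (n - 2)) (c 0)) : False :=
  hG (c '' Set.Icc 0 0) (c '' Set.Icc 2 2) (c '' Set.Icc 4 (n - 2)) (c '' Set.Icc 3 3)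
    (c '' Set.Icc (n - 1) (n - 1)) (c '' Set.Icc 1 1)
    (hc.connected_image_Icc le_rfl) (hc.connected_image_Icc le_rfl)
    (hc.connected_image_Icc (by omega)) (hc.connected_image_Icc le_rfl)
    (hc.connected_image_Icc le_rfl) (hc.connected_image_Icc le_rfl)
    (hc.disjoint_image_Icc (by omega) (by omega) (by omega))
    (hc.disjoint_image_Icc (by omega) (by omega) (by omega))
    (hc.disjoint_image_Icc (by omega) (by omega) (by omega))
    (hc.disjoint_image_Icc (by omega) (by omega) (by omega))
    (hc.disjoint_image_Icc (by omega) (by omega) (by omega))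
    (hc.disjoint_image_Icc (by omega) (by omega) (by omega))
    (hc.disjoint_image_Icc (by omega) (by omega) (by omega))
    (hc.disjoint_image_Icc (by omega) (by omega) (by omega))
    (hc.disjoint_image_Icc (by omega) (by omega) (by omega))
    (hc.disjoint_image_Icc (by omega) (by omega) (by omega))
    (hc.disjoint_image_Icc (by omega) (by omega) (by omega))
    (hc.disjoint_image_Icc (by omega) (by omega) (by omega))
    (touch_image_Icc h02 (by omega) (by omega))
    (touch_image_Icc hl.symm (by omega) (by omega))
    (touch_image_Icc h24 (by omega) (by omega))
    (touch_image_Icc (hc.adj 2).symm (by omega) (by omega))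
    (touch_image_Icc (hc.adj 3) (by omega) (by omega))
    (touch_image_Icc (hc.adj_last (by omega)) (by omega) (by omega))
    (touch_image_Icc (j := n - 2) (by
      have := (hc.adj (n - 2)).symm
      rwa [show n - 2 + 1 = n - 1 by omega] at this) (by omega) (by omega))
    (touch_image_Icc (hc.adj 0).symm (by omega) (by omega))
    (touch_image_Icc (hc.adj 1) (by omega) (by omega))

theorem exists_common_adj [Finite V] (hc : IsCycleSeq G n c) (hG : NoFourCycleModel G)
    (hn : 3 ≤ n) : ∃ j, 2 ≤ j ∧ j < n ∧ G.Adj (c j) (c 0) ∧ G.Adj (c j) (c 1) := by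
  have hnot : ∀ i, i < 2 → c i ∉ c '' Set.Icc 2 (n - 1) := by
    rintro i hi ⟨j, ⟨hj1, hj2⟩, hij⟩
    exact hc.ne i j (by omega) (by omega) hij.symm
  obtain ⟨_, ⟨j, ⟨hj1, hj2⟩, rfl⟩, h⟩ := hG.exists_common_adj (hc.adj 0)
    (hc.connected_image_Icc (a := 2) (b := n - 1) (by omega)) (hnot 0 (by omega))
    (hnot 1 (by omega))
    (touch_of_mem ⟨n - 1, ⟨by omega, le_rfl⟩, rfl⟩ rfl (hc.adj_last (by omega)))
    (touch_of_mem ⟨2, ⟨le_rfl, by omega⟩, rfl⟩ rfl (hc.adj 1).symm)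
  exact ⟨j, hj1, by omega, h⟩

end IsCycleSeq

theorem isStronglyChordal_of_noModel [Finite V] (hC : NoFourCycleModel G) (hK : NoK4Model G)
    (hS : NoSunModel G) : IsStronglyChordal G := by
  refine ⟨hC.isChordal, fun n hn hev f hinj hadj => ?_⟩
  by_contra! hno
  have seq : ∀ r : ZMod n, IsCycleSeq G n fun t => f (r + t) := by
    refine fun r => ⟨fun i j hij hj h => ?_, fun i => ?_, by simp⟩
    · have h' := congrArg ZMod.val (add_left_cancel (hinj h))
      rw [ZMod.val_cast_of_lt (by omega), ZMod.val_cast_of_lt hj] at h'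
      omega
    · rw [Nat.cast_succ, ← add_assoc]
      exact hadj _
  have hlast : ∀ (r : ZMod n) (k : ℕ), k ≤ n → r + ((n - k : ℕ) : ZMod n) = r - k := by
    intro r k hk
    rw [Nat.cast_sub hk, ZMod.natCast_self]
    ring
  have ear : ∀ r : ZMod n, G.Adj (f (r - 1)) (f (r + 1)) ∨ G.Adj (f r) (f (r + 1 + 1)) := by
    intro r
    obtain ⟨j, hj2, hjn, h0, h1⟩ := (seq r).exists_common_adj hC (by omega)
    simp only [Nat.cast_zero, add_zero, Nat.cast_one] at h0 h1
    rcases Nat.even_or_odd j with hj | hj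
    · right
      by_cases h2 : j = 2
      · subst h2
        convert h0.symm using 2
        push_cast
        ring
      · refine (hno (r + 1) (j - 1) (by grind) (by grind) (by grind) ?_).elim
        rw [Nat.cast_sub (by omega)]
        convert h1.symm using 2
        push_cast
        ring
    · left
      by_cases hl : j = n - 1
      · subst hl
        rw [hlast r 1 (by omega)] at h1
        simpa using h1
      · exact (hno r j hj (by grind) (by grind) h0.symm).elim
  have noEar : ∀ r : ZMod n, G.Adj (f (r - 1)) (f (r + 1)) → ¬ G.Adj (f r) (f (r + 1 + 1)) := by
    intro r h1 h2
    refine (seq (r - 1)).not_adj_and_adj hK (by omega) ?_ ?_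
    · convert h1 using 2 <;> push_cast <;> ring
    · convert h2 using 2 <;> push_cast <;> ring
  have step : ∀ r : ZMod n, G.Adj (f r) (f (r + 2)) ↔ ¬ G.Adj (f (r + 1)) (f (r + 3)) := by
    intro r
    have h1 := ear (r + 1)
    have h2 := noEar (r + 1)
    rw [show r + 1 - 1 = r by ring, show r + 1 + 1 = r + 2 by ring,
      show r + 2 + 1 = r + 3 by ring] at h1 h2
    tauto
  obtain ⟨r, hr⟩ : ∃ r : ZMod n, G.Adj (f r) (f (r + 2)) := by
    by_contra! h
    exact h 0 ((step 0).2 (by simpa [show (1 : ZMod n) + 2 = 3 by ring] using h 1))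
  have h2 : ∀ r : ZMod n, G.Adj (f r) (f (r + 2)) ↔ G.Adj (f (r + 2)) (f (r + 4)) := by
    intro r
    have := step (r + 1)
    rw [show r + 1 + 2 = r + 3 by ring, show r + 1 + 1 = r + 2 by ring,
      show r + 1 + 3 = r + 4 by ring] at this
    rw [step r, this, not_not]
  refine (seq r).false_of_noSunModel hS hn ?_ ?_ ?_
  · simpa using hr
  · simpa using (h2 r).1 hr
  · rw [hlast r 2 (by omega)]
    have := h2 (r - 2)
    rw [show r - 2 + 2 = r by ring, show r - 2 + 4 = r + 2 by ring] at this
    simpa using this.2 hr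

end StronglyChordal

/-- The graph obtained from `G` by contracting the sets `f w`, keeping only vertices in them. -/
def minorGraph {V W : Type} (G : SimpleGraph V) (f : W → Set V) : SimpleGraph W where
  Adj w w' := w ≠ w' ∧ Touch G (f w) (f w')
  symm := ⟨fun _ _ h => ⟨h.1.symm, h.2.symm⟩⟩
  loopless := ⟨fun _ h => h.1 rfl⟩

section MinorGraph

variable {V W : Type} {G : SimpleGraph V} {f : W → Set V}

theorem Touch.biUnion (hne : ∀ w, (f w).Nonempty) {A B : Set W}
    (h : Touch (minorGraph G f) A B) : Touch G (⋃ w ∈ A, f w) (⋃ w ∈ B, f w) := by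
  obtain ⟨a, ha, b, hb, rfl | h⟩ := h
  · obtain ⟨v, hv⟩ := hne a
    exact ⟨v, Set.mem_biUnion ha hv, v, Set.mem_biUnion hb hv, Or.inl rfl⟩
  · exact (h.2.mono_left (Set.subset_biUnion_of_mem ha)).mono_right (Set.subset_biUnion_of_mem hb)

theorem Touch.of_biUnion {A B : Set W} (h : Touch G (⋃ w ∈ A, f w) (⋃ w ∈ B, f w)) :
    Touch (minorGraph G f) A B := by
  obtain ⟨u, hu, v, hv, h⟩ := h
  simp only [Set.mem_iUnion, exists_prop] at hu hv
  obtain ⟨a, ha, hu⟩ := hu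
  obtain ⟨b, hb, hv⟩ := hv
  exact ⟨a, ha, b, hb, or_iff_not_imp_left.2 fun hab => ⟨hab, u, hu, v, hv, h⟩⟩

theorem connected_biUnion [Finite W] (hf : ∀ w, (G.induce (f w)).Connected) {S : Set W}
    (hS : ((minorGraph G f).induce S).Connected) : (G.induce (⋃ w ∈ S, f w)).Connected := by
  induction S, hS using connected_set_induction with
  | single w =>
    rw [Set.biUnion_singleton]
    exact hf w
  | union P Q _ _ _ hPQ ihP ihQ =>
    rw [Set.biUnion_union]
    exact (hPQ.biUnion fun w => (hf w).nonempty_of_induce).connected_union ihP ihQ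

theorem disjoint_biUnion (hd : Pairwise fun w w' => Disjoint (f w) (f w')) {A B : Set W}
    (h : Disjoint A B) : Disjoint (⋃ w ∈ A, f w) (⋃ w ∈ B, f w) := by
  simp only [Set.disjoint_iUnion_left, Set.disjoint_iUnion_right]
  exact fun b hb a ha => hd (h.ne_of_mem ha hb)

theorem NoFourCycleModel.minorGraph [Finite W] (hG : NoFourCycleModel G)
    (hf : ∀ w, (G.induce (f w)).Connected) : NoFourCycleModel (minorGraph G f) := by
  have hne := fun w => (hf w).nonempty_of_induce
  intro A B C D hA hB hC hD hAB hBC hCD hDA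
  exact (hG _ _ _ _ (connected_biUnion hf hA) (connected_biUnion hf hB) (connected_biUnion hf hC)
    (connected_biUnion hf hD) (hAB.biUnion hne) (hBC.biUnion hne) (hCD.biUnion hne)
    (hDA.biUnion hne)).imp Touch.of_biUnion Touch.of_biUnion

theorem NoK4Model.minorGraph [Finite W] (hG : NoK4Model G) (hf : ∀ w, (G.induce (f w)).Connected)
    (hd : Pairwise fun w w' => Disjoint (f w) (f w')) : NoK4Model (minorGraph G f) := by
  have hne := fun w => (hf w).nonempty_of_induce
  intro A B C D hA hB hC hD d1 d2 d3 d4 d5 d6 t1 t2 t3 t4 t5 t6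
  exact hG _ _ _ _ (connected_biUnion hf hA) (connected_biUnion hf hB) (connected_biUnion hf hC)
    (connected_biUnion hf hD) (disjoint_biUnion hd d1) (disjoint_biUnion hd d2)
    (disjoint_biUnion hd d3) (disjoint_biUnion hd d4) (disjoint_biUnion hd d5)
    (disjoint_biUnion hd d6) (t1.biUnion hne) (t2.biUnion hne) (t3.biUnion hne) (t4.biUnion hne)
    (t5.biUnion hne) (t6.biUnion hne)

theorem NoSunModel.minorGraph [Finite W] (hG : NoSunModel G) (hf : ∀ w, (G.induce (f w)).Connected)
    (hd : Pairwise fun w w' => Disjoint (f w) (f w')) : NoSunModel (minorGraph G f) := by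
  have hne := fun w => (hf w).nonempty_of_induce
  intro A B C X Y Z hA hB hC hX hY hZ d1 d2 d3 d4 d5 d6 d7 d8 d9 d10 d11 d12 t1 t2 t3 t4 t5 t6 t7
    t8 t9
  exact hG _ _ _ _ _ _ (connected_biUnion hf hA) (connected_biUnion hf hB)
    (connected_biUnion hf hC) (connected_biUnion hf hX) (connected_biUnion hf hY)
    (connected_biUnion hf hZ) (disjoint_biUnion hd d1) (disjoint_biUnion hd d2)
    (disjoint_biUnion hd d3) (disjoint_biUnion hd d4) (disjoint_biUnion hd d5)
    (disjoint_biUnion hd d6) (disjoint_biUnion hd d7) (disjoint_biUnion hd d8)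
    (disjoint_biUnion hd d9) (disjoint_biUnion hd d10) (disjoint_biUnion hd d11)
    (disjoint_biUnion hd d12) (t1.biUnion hne) (t2.biUnion hne) (t3.biUnion hne) (t4.biUnion hne)
    (t5.biUnion hne) (t6.biUnion hne) (t7.biUnion hne) (t8.biUnion hne) (t9.biUnion hne)

end MinorGraph

theorem isStronglyChordal_top {V : Type} : IsStronglyChordal (⊤ : SimpleGraph V) := by
  refine ⟨isChordal_iff_not_isHole.2 fun n hn c hc => ?_, fun n hn _ f hinj _ => ?_⟩
  · obtain ⟨h1, h2⟩ := hc 0 2 (by omega) (by omega)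
    have := h2.1 h1
    omega
  · refine ⟨0, 3, by decide, le_rfl, hn, fun h => ?_⟩
    have h' := congrArg ZMod.val (hinj h)
    rw [zero_add, ZMod.val_cast_of_lt (by omega), ZMod.val_zero] at h'
    omega

theorem sctw_le_iff {V : Type} [Finite V] {G : SimpleGraph V} {k : ℕ} :
    sctw G ≤ k ↔ ∃ H : SimpleGraph V, G ≤ H ∧ IsStronglyChordal H ∧ H.CliqueFree (k + 2) := by
  refine ⟨fun h => ?_, fun h => Nat.sInf_le h⟩
  have hne : {k | ∃ H : SimpleGraph V, G ≤ H ∧ IsStronglyChordal H ∧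
      H.CliqueFree (k + 2)}.Nonempty := by
    have := Fintype.ofFinite V
    exact ⟨Fintype.card V, ⊤, le_top, isStronglyChordal_top, cliqueFree_of_card_lt (by omega)⟩
  obtain ⟨H, hGH, hH, hfree⟩ := Nat.sInf_mem hne
  exact ⟨H, hGH, hH, hfree.mono (Nat.add_le_add_right h 2)⟩

/-- The class of finite simple graphs with strongly chordal treewidth at most two is
closed under taking minors. -/
theorem statement12 {V W : Type} [Fintype V] [Fintype W]
    (G : SimpleGraph V) (H : SimpleGraph W)
    (hG : sctw G ≤ 2) (hH : IsMinorOf H G) : sctw H ≤ 2 := by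
  obtain ⟨G', hle, hS, hfree⟩ := sctw_le_iff.1 hG
  obtain ⟨f, -, hconn, hd, hadj⟩ := hH
  have hconn' : ∀ w, (G'.induce (f w)).Connected := fun w =>
    (hconn w).mono (comap_monotone _ hle)
  have hC := hS.1.noFourCycleModel
  have hK := (hC.noK4Model hfree).minorGraph hconn' hd
  refine sctw_le_iff.2 ⟨minorGraph G' f, fun w w' h => ?_, isStronglyChordal_of_noModel
    (hC.minorGraph hconn') hK ((hC.noSunModel hS hfree).minorGraph hconn' hd), hK.cliqueFree⟩
  obtain ⟨u, hu, v, hv, huv⟩ := hadj h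
  exact ⟨h.ne, touch_of_mem hu hv (hle huv)⟩
end

section
/- Let G be a strongly chordal finite simple graph with clique number at most three, and let e be an edge of G. Then the graph G/e obtained from G by contracting e is strongly chordal. -/
open SimpleGraph

/-- A chordal graph contains no chordless cycle `c 0, …, c (n - 1)` of length `n ≥ 4`. -/
theorem IsChordal.not_chordless_cycle {V : Type} {G : SimpleGraph V} (hG : IsChordal G)
    {n : ℕ} (hn : 4 ≤ n) (c : ℕ → V)
    (hinj : ∀ i j, i < j → j < n → c i ≠ c j)
    (hadj : ∀ i j, i < j → j < n → (G.Adj (c i) (c j) ↔ j = i + 1 ∨ (i = 0 ∧ j + 1 = n))) :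
    False := by
  have : NeZero n := ⟨by omega⟩
  have : Fact (1 < n) := ⟨by omega⟩
  have hinj' : Function.Injective (fun i : ZMod n => c i.val) := by
    intro i j hij
    apply ZMod.val_injective n
    have hi := i.val_lt
    have hj := j.val_lt
    rcases lt_trichotomy i.val j.val with h | h | h
    · exact absurd hij (hinj _ _ h hj)
    · exact h
    · exact absurd hij.symm (hinj _ _ h hi)
  have hsucc : ∀ i j : ZMod n, j = i + 1 ↔
      (j.val = i.val + 1 ∨ (i.val + 1 = n ∧ j.val = 0)) := by
    intro i j
    have hi := i.val_lt
    have hj := j.val_lt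
    rw [← (ZMod.val_injective n).eq_iff, ZMod.val_add, ZMod.val_one]
    rcases Nat.lt_or_ge (i.val + 1) n with h | h
    · rw [Nat.mod_eq_of_lt h]; omega
    · have : i.val + 1 = n := by omega
      rw [this, Nat.mod_self]; omega
  refine hG (Set.range (fun i : ZMod n => c i.val)) n hn ⟨RelIso.symm
    ⟨Equiv.ofInjective _ hinj', ?_⟩⟩
  intro i j
  have hi := i.val_lt
  have hj := j.val_lt
  simp only [comap_adj, Equiv.ofInjective_apply, Function.Embedding.subtype_apply, cycGraph,
    fromRel_adj, hsucc, ne_eq, ← (ZMod.val_injective n).eq_iff]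
  rcases lt_trichotomy i.val j.val with h | h | h
  · rw [hadj _ _ h hj]; omega
  · simp [h]
  · rw [G.adj_comm, hadj _ _ h hi]; omega

/-- The odd chord of an even cycle `c 0, …, c (n - 1)` in a strongly chordal graph. -/
theorem IsStronglyChordal.exists_odd_chord {V : Type} {G : SimpleGraph V}
    (hG : IsStronglyChordal G) {n : ℕ} (hn : 6 ≤ n) (hev : Even n) (c : ℕ → V)
    (hinj : ∀ i j, i < j → j < n → c i ≠ c j)
    (hadj : ∀ i, i + 1 < n → G.Adj (c i) (c (i + 1)))
    (hlast : G.Adj (c (n - 1)) (c 0)) :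
    ∃ i j, i < j ∧ j < n ∧ Odd (j - i) ∧ 3 ≤ j - i ∧ j - i + 3 ≤ n ∧ G.Adj (c i) (c j) := by
  have : NeZero n := ⟨by omega⟩
  have : Fact (1 < n) := ⟨by omega⟩
  obtain ⟨i, d, hd, h3, hdn, h⟩ := hG.2 n hn hev (fun i => c i.val) (by
      intro i j hij
      apply ZMod.val_injective n
      have hi := i.val_lt
      have hj := j.val_lt
      rcases lt_trichotomy i.val j.val with h | h | h
      · exact absurd hij (hinj _ _ h hj)
      · exact h
      · exact absurd hij.symm (hinj _ _ h hi)) (by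
      intro i
      have hi := i.val_lt
      simp only [ZMod.val_add, ZMod.val_one]
      rcases Nat.lt_or_ge (i.val + 1) n with h | h
      · rw [Nat.mod_eq_of_lt h]; exact hadj _ h
      · have h1 : i.val + 1 = n := by omega
        rw [h1, Nat.mod_self]
        have h2 : i.val = n - 1 := by omega
        rw [h2]; exact hlast)
  have hi := i.val_lt
  simp only [ZMod.val_add, ZMod.val_natCast, Nat.add_mod_mod] at h
  rcases Nat.lt_or_ge (i.val + d) n with h' | h'
  · rw [Nat.mod_eq_of_lt h'] at h
    exact ⟨i.val, i.val + d, by omega, h', by rwa [Nat.add_sub_cancel_left], by omega, by omega, h⟩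
  · rw [Nat.mod_eq_sub_mod h', Nat.mod_eq_of_lt (by omega)] at h
    refine ⟨i.val + d - n, i.val, by omega, hi, ?_, by omega, by omega, h.symm⟩
    have : i.val - (i.val + d - n) = n - d := by omega
    rw [this]
    exact Nat.Even.sub_odd (by omega) hev hd

/-- In a chordal graph, an edge `x y` on a closed walk `x, g 0, …, g d, y` has a common neighbour
among the other vertices of the walk. -/
theorem IsChordal.exists_common_neighbor {V : Type} {G : SimpleGraph V} (hG : IsChordal G)
    {x y : V} (hxy : G.Adj x y) (d : ℕ) : ∀ g : ℕ → V,
    (∀ i < d, G.Adj (g i) (g (i + 1))) → (∀ i ≤ d, g i ≠ x ∧ g i ≠ y) →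
    G.Adj x (g 0) → G.Adj y (g d) → ∃ i ≤ d, G.Adj x (g i) ∧ G.Adj y (g i) := by
  induction d using Nat.strong_induction_on with
  | _ d ih =>
  intro g hg hne h0 hd
  by_cases hd0 : d = 0
  · subst hd0; exact ⟨0, le_rfl, h0, hd⟩
  by_cases hx : ∃ i, 1 ≤ i ∧ i ≤ d ∧ G.Adj x (g i)
  · obtain ⟨i, hi1, hid, hxi⟩ := hx
    obtain ⟨j, hj, h⟩ := ih (d - i) (by omega) (fun t => g (i + t))
      (fun t ht => hg (i + t) (by omega)) (fun t ht => hne _ (by omega)) hxi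
      (by rwa [show i + (d - i) = d by omega])
    exact ⟨i + j, by omega, h⟩
  by_cases hy : ∃ i, i < d ∧ G.Adj y (g i)
  · obtain ⟨i, hid, hyi⟩ := hy
    obtain ⟨j, hj, h⟩ := ih i hid g (fun t ht => hg t (by omega)) (fun t ht => hne _ (by omega))
      h0 hyi
    exact ⟨j, by omega, h⟩
  by_cases hc : ∃ i j, i + 1 < j ∧ j ≤ d ∧ G.Adj (g i) (g j)
  · obtain ⟨i, j, hij, hjd, hadj⟩ := hc
    obtain ⟨t, ht, h⟩ := ih (d - (j - i - 1)) (by omega)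
      (fun t => if t ≤ i then g t else g (t + (j - i - 1)))
      (by
        intro t ht
        rcases lt_trichotomy t i with h | h | h
        · rw [if_pos (by omega), if_pos (by omega)]; exact hg t (by omega)
        · rw [if_pos (by omega), if_neg (by omega), h, show i + 1 + (j - i - 1) = j by omega]
          exact hadj
        · rw [if_neg (by omega), if_neg (by omega), show t + 1 + (j - i - 1) =
            t + (j - i - 1) + 1 by omega]
          exact hg _ (by omega))
      (by
        intro t ht
        split_ifs <;> exact hne _ (by omega))
      (by simpa using h0)
      (by
        rw [if_neg (by omega), show d - (j - i - 1) + (j - i - 1) = d by omega]; exact hd)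
    split_ifs at h
    · exact ⟨t, by omega, h⟩
    · exact ⟨_, by omega, h⟩
  push Not at hx hy hc
  exfalso
  have hginj : ∀ i j, i < j → j ≤ d → g i ≠ g j := by
    intro i j hij hjd heq
    rcases Nat.lt_or_ge j d with h | h
    · exact hc i (j + 1) (by omega) (by omega) (heq ▸ hg j h)
    · have : j = d := by omega
      subst this
      exact hy i hij (heq ▸ hd)
  refine hG.not_chordless_cycle (n := d + 3) (by omega)
    (fun t => if t ≤ d then g t else if t = d + 1 then y else x) ?_ ?_
  · intro i j hij hj
    split_ifs with h1 h2 h3 h4 h5 h6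
    · exact hginj i j hij h2
    · exact (hne i h1).2
    · exact (hne i h1).1
    all_goals first | omega | exact hxy.ne'
  · intro i j hij hj
    split_ifs with h1 h2 h3 h4 h5 h6
    · constructor
      · intro h
        by_contra hcon
        exact hc i j (by omega) h2 h
      · intro h
        obtain rfl : j = i + 1 := by omega
        exact hg i (by omega)
    · constructor
      · intro h
        by_contra hcon
        exact hy i (by omega) h.symm
      · intro h
        obtain rfl : i = d := by omega
        exact hd.symm
    · constructor
      · intro h
        by_contra hcon
        exact hx i (by omega) h1 h.symm
      · intro h
        obtain rfl : i = 0 := by omega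
        exact h0.symm
    all_goals first | omega | exact iff_of_true hxy.symm (by omega)

/-- `IsChordal.exists_common_neighbor` for a walk indexed by an interval `[l, m]`. -/
theorem IsChordal.exists_common_neighbor_Icc {V : Type} {G : SimpleGraph V} (hG : IsChordal G)
    {x y : V} (hxy : G.Adj x y) {l m : ℕ} (hlm : l ≤ m) (g : ℕ → V)
    (hg : ∀ i, l ≤ i → i < m → G.Adj (g i) (g (i + 1)))
    (hne : ∀ i, l ≤ i → i ≤ m → g i ≠ x ∧ g i ≠ y)
    (hl : G.Adj x (g l)) (hm : G.Adj y (g m)) :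
    ∃ i, l ≤ i ∧ i ≤ m ∧ G.Adj x (g i) ∧ G.Adj y (g i) := by
  obtain ⟨i, hi, h⟩ := hG.exists_common_neighbor hxy (m - l) (fun t => g (l + t))
    (fun t ht => hg (l + t) (by omega) (by omega)) (fun t ht => hne _ (by omega) (by omega)) hl
    (by rwa [show l + (m - l) = m by omega])
  exact ⟨l + i, by omega, by omega, h⟩

/-- In a chordal graph without `K₄`, the ends of a path avoiding the edge `a b` are not both
common neighbours of `a` and `b`. -/
theorem IsChordal.not_two_common_neighbors {V : Type} {G : SimpleGraph V} (hG : IsChordal G)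
    (hω : G.CliqueFree 4) {a b : V} (hab : G.Adj a b) {k l : ℕ} (hkl : k < l) (c : ℕ → V)
    (hinj : ∀ i j, k ≤ i → i < j → j ≤ l → c i ≠ c j)
    (hadj : ∀ i, k ≤ i → i < l → G.Adj (c i) (c (i + 1)))
    (hne : ∀ i, k ≤ i → i ≤ l → c i ≠ a ∧ c i ≠ b)
    (hak : G.Adj a (c k)) (hbk : G.Adj b (c k)) (hal : G.Adj a (c l)) (hbl : G.Adj b (c l)) :
    False := by
  classical
  obtain ⟨r, ⟨hkr, hrl, hr⟩, hmax⟩ : ∃ r, (k < r ∧ r ≤ l ∧ G.Adj (c k) (c r)) ∧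
      ∀ s, k < s ∧ s ≤ l ∧ G.Adj (c k) (c s) → s ≤ r := by
    have hP : (fun r => k < r ∧ r ≤ l ∧ G.Adj (c k) (c r)) (k + 1) :=
      ⟨by omega, by omega, hadj k le_rfl hkl⟩
    exact ⟨_, Nat.findGreatest_spec (P := fun r => k < r ∧ r ≤ l ∧ G.Adj (c k) (c r))
      (Nat.succ_le_of_lt hkl) hP, fun s hs => Nat.le_findGreatest hs.2.1 hs⟩
  have key : ∀ z, G.Adj z (c k) → G.Adj z (c l) → (∀ i, k ≤ i → i ≤ l → c i ≠ z) →
      G.Adj z (c r) := by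
    intro z hz hzl hzne
    obtain ⟨i, hi, hil, h1, h2⟩ := hG.exists_common_neighbor_Icc hz.symm hrl c
      (fun i hi hi' => hadj i (by omega) hi')
      (fun i hi hi' => ⟨(hinj k i le_rfl (by omega) hi').symm, hzne i (by omega) hi'⟩) hr hzl
    have := hmax i ⟨by omega, hil, h1⟩
    obtain rfl : i = r := by omega
    exact h2
  have har := key a hak hal (fun i h h' => (hne i h h').1)
  have hbr := key b hbk hbl (fun i h h' => (hne i h h').2)
  refine hω {a, b, c k, c r} ?_
  refine ((is3Clique_triple_iff.2 ⟨hbk, hbr, hr⟩).insert ?_)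
  simp [hab, hak, har]

/-- Contracting the edge `a b` does not create a chordless cycle through the contracted vertex. -/
theorem IsChordal.not_chordless_cycle_through_edge {V : Type} {G : SimpleGraph V}
    (hG : IsChordal G) {a b : V} (hab : G.Adj a b) {n : ℕ} (hn : 4 ≤ n) (c : ℕ → V)
    (hinj : ∀ i j, 1 ≤ i → i < j → j < n → c i ≠ c j)
    (hne : ∀ i, 1 ≤ i → i < n → c i ≠ a ∧ c i ≠ b)
    (hadj : ∀ i j, 1 ≤ i → i < j → j < n → (G.Adj (c i) (c j) ↔ j = i + 1))
    (hN : ∀ j, 1 ≤ j → j < n → ((G.Adj a (c j) ∨ G.Adj b (c j)) ↔ j = 1 ∨ j + 1 = n)) :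
    False := by
  have one : ∀ z, (∀ i, 1 ≤ i → i < n → c i ≠ z) →
      (∀ j, 1 ≤ j → j < n → G.Adj z (c j) → G.Adj a (c j) ∨ G.Adj b (c j)) →
      G.Adj z (c 1) → G.Adj z (c (n - 1)) → False := by
    intro z hzne hzN h1 h2
    refine hG.not_chordless_cycle hn (fun t => if t = 0 then z else c t) ?_ ?_
    · intro i j hij hj
      rw [if_neg (show j ≠ 0 by omega)]
      split_ifs with h
      · exact (hzne j (by omega) hj).symm
      · exact hinj i j (by omega) hij hj
    · intro i j hij hj
      rw [if_neg (show j ≠ 0 by omega)]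
      split_ifs with h
      · constructor
        · intro hz
          have := (hN j (by omega) hj).1 (hzN j (by omega) hj hz)
          omega
        · intro h'
          rcases h' with h' | h'
          · rwa [show j = 1 by omega]
          · rwa [show j = n - 1 by omega]
      · rw [hadj i j (by omega) hij hj]; omega
  have ha := one a (fun i h h' => (hne i h h').1) (fun j _ _ h => Or.inl h)
  have hb := one b (fun i h h' => (hne i h h').2) (fun j _ _ h => Or.inr h)
  have two : ∀ x y, G.Adj x y → (∀ i, 1 ≤ i → i < n → c i ≠ x ∧ c i ≠ y) →
      (∀ j, 1 ≤ j → j < n → G.Adj x (c j) → G.Adj a (c j) ∨ G.Adj b (c j)) →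
      (G.Adj x (c 1) → G.Adj x (c (n - 1)) → False) →
      (G.Adj y (c 1) → G.Adj y (c (n - 1)) → False) →
      G.Adj x (c 1) → G.Adj y (c (n - 1)) → False := by
    intro x y hxy hxyne hxN hx hy h1 h2
    obtain ⟨i, hi, hi', h3, h4⟩ := hG.exists_common_neighbor_Icc hxy (show 1 ≤ n - 1 by omega) c
      (fun i h h' => (hadj i (i + 1) h (by omega) (by omega)).2 rfl)
      (fun i h h' => hxyne i h (by omega)) h1 h2
    rcases (hN i hi (by omega)).1 (hxN i hi (by omega) h3) with h | h
    · subst h; exact hy h4 h2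
    · obtain rfl : i = n - 1 := by omega
      exact hx h1 h3
  have h1 := (hN 1 le_rfl (by omega)).2 (Or.inl rfl)
  have h2 := (hN (n - 1) (by omega) (by omega)).2 (Or.inr (by omega))
  rcases h1 with h1 | h1 <;> rcases h2 with h2 | h2
  · exact ha h1 h2
  · exact two a b hab hne (fun j _ _ h => Or.inl h) ha hb h1 h2
  · exact two b a hab.symm (fun i h h' => (hne i h h').symm) (fun j _ _ h => Or.inr h) hb ha h1 h2
  · exact hb h1 h2

/-- If `a b` is the base of a cycle `b, c 1, …, c k, a` with `k ≥ 4` even, and `c k` is the first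
common neighbour of `a` and `b` on it, then the cycle has an odd chord avoiding `a`. -/
theorem IsStronglyChordal.exists_odd_chord_avoiding {V : Type} {G : SimpleGraph V}
    (hG : IsStronglyChordal G) {a b : V} (hab : G.Adj a b) {k : ℕ} (hk : 4 ≤ k) (hev : Even k)
    (c : ℕ → V)
    (hinj : ∀ i j, 1 ≤ i → i < j → j ≤ k → c i ≠ c j)
    (hne : ∀ i, 1 ≤ i → i ≤ k → c i ≠ a ∧ c i ≠ b)
    (hadj : ∀ i, 1 ≤ i → i < k → G.Adj (c i) (c (i + 1)))
    (hb : G.Adj b (c 1)) (ha : G.Adj a (c k))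
    (hmin : ∀ i, 1 ≤ i → i < k → G.Adj a (c i) → G.Adj b (c i) → False) :
    ∃ i j, i < j ∧ j ≤ k ∧ Odd (j - i) ∧ 3 ≤ j - i ∧ j - i + 1 ≤ k ∧
      ((1 ≤ i ∧ G.Adj (c i) (c j)) ∨ (i = 0 ∧ G.Adj b (c j))) := by
  obtain ⟨i, j, hij, hj, hodd, h3, hlt, h⟩ := hG.exists_odd_chord (n := k + 2) (by omega)
    (hev.add even_two) (fun t => if t = 0 then b else if t ≤ k then c t else a)
    (by
      intro i j hij hj
      rw [if_neg (show j ≠ 0 by omega)]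
      split_ifs with h1 h2 h3 h4
      · exact (hne j (by omega) h2).2.symm
      · exact hab.ne'
      · exact hinj i j (by omega) hij h4
      · exact (hne i (by omega) h3).1
      all_goals omega)
    (by
      intro i hi
      rw [if_neg (show i + 1 ≠ 0 by omega)]
      split_ifs with h1 h2 h3 h4
      · subst h1; exact hb
      · omega
      · exact hadj i (by omega) (by omega)
      · obtain rfl : i = k := by omega
        exact ha.symm
      all_goals omega)
    (by simpa using hab)
  rw [if_neg (show j ≠ 0 by omega)] at h
  split_ifs at h with h1 h2 h4 h5
  · exact ⟨i, j, hij, h2, hodd, h3, by omega, Or.inr ⟨h1, h⟩⟩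
  · omega
  · exact ⟨i, j, hij, h5, hodd, h3, by omega, Or.inl ⟨by omega, h⟩⟩
  · exfalso
    obtain ⟨t, ht, hti, h6, h7⟩ := hG.1.exists_common_neighbor_Icc hab.symm
      (show 1 ≤ i by omega) c (fun s hs hs' => hadj s hs (by omega))
      (fun s hs hs' => (hne s hs (by omega)).symm) hb h.symm
    exact hmin t ht (by omega) h7 h6
  all_goals omega

/-- An even cycle of length at least six through the vertex arising by contraction of `a b` has an
odd chord, if its two neighbours on the cycle are adjacent to different ends of `a b`. -/
theorem IsStronglyChordal.exists_odd_chord_through_edge_aux {V : Type} {G : SimpleGraph V}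
    (hG : IsStronglyChordal G) (hω : G.CliqueFree 4) {a b : V} (hab : G.Adj a b)
    {n : ℕ} (hn : 6 ≤ n) (hev : Even n) (c : ℕ → V)
    (hinj : ∀ i j, 1 ≤ i → i < j → j < n → c i ≠ c j)
    (hne : ∀ i, 1 ≤ i → i < n → c i ≠ a ∧ c i ≠ b)
    (hadj : ∀ i, 1 ≤ i → i + 1 < n → G.Adj (c i) (c (i + 1)))
    (hb : G.Adj b (c 1)) (ha : G.Adj a (c (n - 1)))
    (ha' : ¬ G.Adj a (c 1)) (hb' : ¬ G.Adj b (c (n - 1))) :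
    ∃ i j, i < j ∧ j < n ∧ Odd (j - i) ∧ 3 ≤ j - i ∧ j - i + 3 ≤ n ∧
      ((1 ≤ i ∧ G.Adj (c i) (c j)) ∨ (i = 0 ∧ (G.Adj a (c j) ∨ G.Adj b (c j)))) := by
  obtain ⟨k, hk1, hkn, hbk, hak⟩ := hG.1.exists_common_neighbor_Icc hab.symm
    (show 1 ≤ n - 1 by omega) c (fun i h h' => hadj i h (by omega))
    (fun i h h' => (hne i h (by omega)).symm) hb ha
  have hk1' : k ≠ 1 := by rintro rfl; exact ha' hak
  have hkn' : k ≠ n - 1 := by rintro rfl; exact hb' hbk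
  have huniq : ∀ i j, 1 ≤ i → i < j → j < n → G.Adj a (c i) → G.Adj b (c i) →
      G.Adj a (c j) → G.Adj b (c j) → False := by
    intro i j hi hij hj h1 h2 h3 h4
    exact hG.1.not_two_common_neighbors hω hab hij c
      (fun s t hs hst ht => hinj s t (by omega) hst (by omega))
      (fun s hs hs' => hadj s (by omega) (by omega))
      (fun s hs hs' => hne s (by omega) (by omega)) h1 h2 h3 h4
  rcases Nat.even_or_odd k with hke | hko
  · by_cases hk4 : 4 ≤ k
    · obtain ⟨i, j, hij, hj, hodd, h3, hlt, h⟩ := hG.exists_odd_chord_avoiding hab hk4 hke c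
        (fun i j hi hij hj => hinj i j hi hij (by omega)) (fun i hi hi' => hne i hi (by omega))
        (fun i hi hi' => hadj i hi (by omega)) hb hak
        (fun i hi hik h1 h2 => huniq i k hi hik (by omega) h1 h2 hak hbk)
      exact ⟨i, j, hij, by omega, hodd, h3, by grind,
        h.imp id (fun h => ⟨h.1, Or.inr h.2⟩)⟩
    · obtain ⟨i, j, hij, hj, hodd, h3, hlt, h⟩ := hG.exists_odd_chord_avoiding hab.symm
        (k := n - k) (by grind) (by grind) (fun t => c (n - t))
        (fun i j hi hij hj => (hinj (n - j) (n - i) (by omega) (by omega) (by omega)).symm)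
        (fun i hi hi' => (hne (n - i) (by omega) (by omega)).symm)
        (fun i hi hi' => by
          have := hadj (n - (i + 1)) (by omega) (by omega)
          rw [show n - (i + 1) + 1 = n - i by omega] at this
          exact this.symm) ha (by rwa [show n - (n - k) = k by omega])
        (fun i hi hik h1 h2 => huniq k (n - i) hk1 (by omega) (by omega) hak hbk h2 h1)
      rcases h with ⟨hi, h⟩ | ⟨rfl, h⟩
      · exact ⟨n - j, n - i, by omega, by omega, by rwa [show n - i - (n - j) = j - i by omega],
          by omega, by omega, Or.inl ⟨by omega, h.symm⟩⟩
      · exact ⟨0, n - j, by omega, by omega, by grind, by grind, by grind, Or.inr ⟨rfl, Or.inl h⟩⟩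
  · exact ⟨0, k, by omega, by omega, by simpa using hko, by grind, by grind,
      Or.inr ⟨rfl, Or.inl hak⟩⟩

/-- An even cycle of length at least six through the vertex arising by contraction of `a b` has an
odd chord. -/
theorem IsStronglyChordal.exists_odd_chord_through_edge {V : Type} {G : SimpleGraph V}
    (hG : IsStronglyChordal G) (hω : G.CliqueFree 4) {a b : V} (hab : G.Adj a b)
    {n : ℕ} (hn : 6 ≤ n) (hev : Even n) (c : ℕ → V)
    (hinj : ∀ i j, 1 ≤ i → i < j → j < n → c i ≠ c j)
    (hne : ∀ i, 1 ≤ i → i < n → c i ≠ a ∧ c i ≠ b)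
    (hadj : ∀ i, 1 ≤ i → i + 1 < n → G.Adj (c i) (c (i + 1)))
    (h1 : G.Adj a (c 1) ∨ G.Adj b (c 1)) (h2 : G.Adj a (c (n - 1)) ∨ G.Adj b (c (n - 1))) :
    ∃ i j, i < j ∧ j < n ∧ Odd (j - i) ∧ 3 ≤ j - i ∧ j - i + 3 ≤ n ∧
      ((1 ≤ i ∧ G.Adj (c i) (c j)) ∨ (i = 0 ∧ (G.Adj a (c j) ∨ G.Adj b (c j)))) := by
  have one : ∀ z, (∀ i, 1 ≤ i → i < n → c i ≠ z) → G.Adj z (c 1) → G.Adj z (c (n - 1)) →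
      ∃ i j, i < j ∧ j < n ∧ Odd (j - i) ∧ 3 ≤ j - i ∧ j - i + 3 ≤ n ∧
      ((1 ≤ i ∧ G.Adj (c i) (c j)) ∨ (i = 0 ∧ G.Adj z (c j))) := by
    intro z hz hz1 hz2
    obtain ⟨i, j, hij, hj, hodd, h3, hlt, h⟩ := hG.exists_odd_chord hn hev
      (fun t => if t = 0 then z else c t)
      (by
        intro i j hij hj
        rw [if_neg (show j ≠ 0 by omega)]
        split_ifs with h
        · exact (hz j (by omega) hj).symm
        · exact hinj i j (by omega) hij hj)
      (by
        intro i hi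
        rw [if_neg (show i + 1 ≠ 0 by omega)]
        split_ifs with h
        · subst h; exact hz1
        · exact hadj i (by omega) hi)
      (by
        rw [if_neg (show n - 1 ≠ 0 by omega), if_pos rfl]; exact hz2.symm)
    rw [if_neg (show j ≠ 0 by omega)] at h
    refine ⟨i, j, hij, hj, hodd, h3, hlt, ?_⟩
    split_ifs at h with h0
    · exact Or.inr ⟨h0, h⟩
    · exact Or.inl ⟨by omega, h⟩
  by_cases haa : G.Adj a (c 1) ∧ G.Adj a (c (n - 1))
  · obtain ⟨i, j, hij, hj, hodd, h3, hlt, h⟩ := one a (fun i h h' => (hne i h h').1) haa.1 haa.2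
    exact ⟨i, j, hij, hj, hodd, h3, hlt, h.imp id (fun h => ⟨h.1, Or.inl h.2⟩)⟩
  by_cases hbb : G.Adj b (c 1) ∧ G.Adj b (c (n - 1))
  · obtain ⟨i, j, hij, hj, hodd, h3, hlt, h⟩ := one b (fun i h h' => (hne i h h').2) hbb.1 hbb.2
    exact ⟨i, j, hij, hj, hodd, h3, hlt, h.imp id (fun h => ⟨h.1, Or.inr h.2⟩)⟩
  by_cases ha1 : G.Adj a (c 1)
  · obtain ⟨i, j, hij, hj, hodd, h3, hlt, h⟩ := hG.exists_odd_chord_through_edge_aux hω hab.symm hn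
      hev c hinj (fun i h h' => (hne i h h').symm) hadj ha1 (by tauto) (by tauto) (by tauto)
    exact ⟨i, j, hij, hj, hodd, h3, hlt, h.imp id (fun h => ⟨h.1, h.2.symm⟩)⟩
  · exact hG.exists_odd_chord_through_edge_aux hω hab hn hev c hinj hne hadj (by tauto) (by tauto)
      ha1 (by tauto)

theorem contractEdge_adj_of_ne {V : Type} {G : SimpleGraph V} {a b : V} {x y : {x : V // x ≠ b}}
    (hx : x.1 ≠ a) (hy : y.1 ≠ a) : (contractEdge G a b).Adj x y ↔ G.Adj x.1 y.1 := by
  simp only [contractEdge, fromRel_adj, hx, hy, false_and, or_false, G.adj_comm y.1 x.1, or_self,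
    and_iff_right_iff_imp]
  exact fun h h' => h.ne (congrArg _ h')

theorem contractEdge_adj_of_eq {V : Type} {G : SimpleGraph V} {a b : V} {x y : {x : V // x ≠ b}}
    (hx : x.1 = a) (hy : y.1 ≠ a) :
    (contractEdge G a b).Adj x y ↔ (G.Adj a y.1 ∨ G.Adj b y.1) := by
  have hxy : x ≠ y := by rintro rfl; exact hy hx
  simp only [contractEdge, fromRel_adj, hx, hy, G.adj_comm y.1 a, ne_eq, hxy, not_false_eq_true,
    true_and, false_and, or_false]
  tauto

theorem injOn_add_natCast {W : Type} {n : ℕ} {h : ZMod n → W} (hh : Function.Injective h)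
    (i₀ : ZMod n) {i j : ℕ} (hij : i < j) (hj : j < n) : h (i₀ + i) ≠ h (i₀ + j) := by
  intro heq
  have h1 := add_left_cancel (hh heq)
  rw [ZMod.natCast_eq_natCast_iff', Nat.mod_eq_of_lt (hij.trans hj), Nat.mod_eq_of_lt hj] at h1
  omega

/-- Contracting an edge of a chordal graph yields a chordal graph. -/
theorem IsChordal.contractEdge {V : Type} {G : SimpleGraph V} (hG : IsChordal G) {a b : V}
    (hab : G.Adj a b) : IsChordal (contractEdge G a b) := by
  rintro S n hn ⟨φ⟩
  have : NeZero n := ⟨by omega⟩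
  set h : ZMod n → {x : V // x ≠ b} := fun i => (φ.symm i).1 with hdef
  have hinj : Function.Injective h := Subtype.val_injective.comp φ.symm.injective
  have hadj : ∀ i j, (_root_.contractEdge G a b).Adj (h i) (h j) ↔ (cycGraph n).Adj i j :=
    fun i j => φ.symm.map_adj_iff
  have hcyc : ∀ (i₀ : ZMod n) (i j : ℕ), i < j → j < n →
      ((_root_.contractEdge G a b).Adj (h (i₀ + i)) (h (i₀ + j)) ↔
        j = i + 1 ∨ (i = 0 ∧ j + 1 = n)) := by
    intro i₀ i j hij hj
    rw [hadj]
    have e1 : i₀ + (i : ZMod n) ≠ i₀ + j :=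
      injOn_add_natCast Function.injective_id i₀ hij hj
    simp only [cycGraph, fromRel_adj, e1, ne_eq, not_false_eq_true, true_and, add_assoc,
      add_right_inj]
    rw [← Nat.cast_succ, ← Nat.cast_succ, ZMod.natCast_eq_natCast_iff',
      ZMod.natCast_eq_natCast_iff', Nat.mod_eq_of_lt (hij.trans hj), Nat.mod_eq_of_lt hj,
      Nat.mod_eq_of_lt (show i.succ < n by omega)]
    rcases Nat.lt_or_ge (j + 1) n with h' | h'
    · rw [Nat.mod_eq_of_lt h']; omega
    · have h2 : j.succ = n := by omega
      rw [h2, Nat.mod_self]; omega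
  by_cases ha : ∃ i₀, (h i₀).1 = a
  · obtain ⟨i₀, hi₀⟩ := ha
    have h0 : (h (i₀ + (0 : ℕ))).1 = a := by simpa using hi₀
    have hnea : ∀ i : ℕ, 1 ≤ i → i < n → (h (i₀ + i)).1 ≠ a := by
      intro i h1 h2 heq
      exact injOn_add_natCast hinj i₀ (show 0 < i by omega) h2 (Subtype.ext (h0.trans heq.symm))
    refine hG.not_chordless_cycle_through_edge hab hn (fun t => (h (i₀ + t)).1) ?_ ?_ ?_ ?_
    · intro i j _ hij hj heq
      exact injOn_add_natCast hinj i₀ hij hj (Subtype.ext heq)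
    · exact fun i h1 h2 => ⟨hnea i h1 h2, (h (i₀ + i)).2⟩
    · intro i j hi hij hj
      rw [← contractEdge_adj_of_ne (hnea i hi (by omega)) (hnea j (by omega) hj),
        hcyc i₀ i j hij hj]
      omega
    · intro j h1 h2
      rw [← contractEdge_adj_of_eq h0 (hnea j h1 h2), hcyc i₀ 0 j (by omega) h2]
      omega
  · push Not at ha
    refine hG.not_chordless_cycle hn (fun t => (h (0 + t)).1) ?_ ?_
    · intro i j hij hj heq
      exact injOn_add_natCast hinj 0 hij hj (Subtype.ext heq)
    · intro i j hij hj
      rw [← contractEdge_adj_of_ne (ha _) (ha _), hcyc 0 i j hij hj]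

/-- Contracting an edge of a strongly chordal graph with clique number at most three
yields a strongly chordal graph. -/
theorem statement13 {V : Type} [Fintype V] (G : SimpleGraph V)
    (hsc : IsStronglyChordal G) (hω : G.CliqueFree 4)
    (a b : V) (hab : G.Adj a b) :
    IsStronglyChordal (contractEdge G a b) := by
  refine ⟨hsc.1.contractEdge hab, ?_⟩
  intro n hn hev f hinj hadj
  have : NeZero n := ⟨by omega⟩
  by_cases ha : ∃ i₀, (f i₀).1 = a
  · obtain ⟨i₀, hi₀⟩ := ha
    have h0 : (f (i₀ + (0 : ℕ))).1 = a := by simpa using hi₀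
    have hnea : ∀ i : ℕ, 1 ≤ i → i < n → (f (i₀ + i)).1 ≠ a := by
      intro i h1 h2 heq
      exact injOn_add_natCast hinj i₀ (show 0 < i by omega) h2 (Subtype.ext (h0.trans heq.symm))
    obtain ⟨i, j, hij, hj, hodd, h3, hlt, h⟩ := hsc.exists_odd_chord_through_edge hω hab hn hev
      (fun t => (f (i₀ + t)).1)
      (fun i j _ hij hj heq => injOn_add_natCast hinj i₀ hij hj (Subtype.ext heq))
      (fun i h1 h2 => ⟨hnea i h1 h2, (f (i₀ + i)).2⟩)
      (fun i h1 h2 => by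
        rw [← contractEdge_adj_of_ne (hnea i h1 (by omega)) (hnea (i + 1) (by omega) h2)]
        simpa [add_assoc] using hadj (i₀ + i))
      (by
        rw [← contractEdge_adj_of_eq h0 (hnea 1 le_rfl (by omega))]
        simpa using hadj i₀)
      (by
        rw [← contractEdge_adj_of_eq h0 (hnea (n - 1) (by omega) (by omega)), adj_comm]
        have := hadj (i₀ + ((n - 1 : ℕ) : ZMod n))
        rw [add_assoc, ← Nat.cast_succ, Nat.succ_eq_add_one, Nat.sub_add_cancel (by omega),
          ZMod.natCast_self] at this
        simpa using this)
    refine ⟨i₀ + i, j - i, hodd, h3, hlt, ?_⟩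
    rw [add_assoc, ← Nat.cast_add, Nat.add_sub_cancel' hij.le]
    rcases h with ⟨hi, h⟩ | ⟨rfl, h⟩
    · rwa [contractEdge_adj_of_ne (hnea i hi (by omega)) (hnea j (by omega) hj)]
    · rwa [contractEdge_adj_of_eq h0 (hnea j (by omega) hj)]
  · push Not at ha
    obtain ⟨i, d, hd, h3, hdn, h⟩ := hsc.2 n hn hev (fun i => (f i).1)
      (Subtype.val_injective.comp hinj)
      (fun i => (contractEdge_adj_of_ne (ha _) (ha _)).1 (hadj i))
    exact ⟨i, d, hd, h3, hdn, (contractEdge_adj_of_ne (ha _) (ha _)).2 h⟩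
end

section
/- Let G be a chordal finite simple graph and let e be an edge of G such that the contraction G/e is isomorphic to S_3. Then either G is not strongly chordal, or the clique number of G equals four. -/
open SimpleGraph

/-- In a chordal graph every 4-cycle has a chord. -/
theorem IsChordal.adj_or_adj {V : Type} {G : SimpleGraph V} (h : IsChordal G) {p q r s : V}
    (hpq : G.Adj p q) (hqr : G.Adj q r) (hrs : G.Adj r s) (hsp : G.Adj s p)
    (hpr : p ≠ r) (hqs : q ≠ s) : G.Adj p r ∨ G.Adj q s := by
  by_contra! hn
  obtain ⟨hn₁, hn₂⟩ := hn
  let f : ZMod 4 → V := (![p, q, r, s] : Fin 4 → V)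
  have hf : Function.Injective f := by
    change Function.Injective (![p, q, r, s] : Fin 4 → V)
    intro i j hij
    have := hpq.ne
    have := hqr.ne
    have := hrs.ne
    have := hsp.ne
    fin_cases i <;> fin_cases j <;> simp_all
  have hadj : ∀ i j : ZMod 4, G.Adj (f i) (f j) ↔ (cycGraph 4).Adj i j := by
    have hcyc : ∀ i j : ZMod 4, (cycGraph 4).Adj i j ↔ i ≠ j ∧ (i = j + 1 ∨ j = i + 1) :=
      fun i j => Iff.rfl
    intro i j
    rw [hcyc]
    change Fin 4 at i j
    change G.Adj ((![p, q, r, s] : Fin 4 → V) i) ((![p, q, r, s] : Fin 4 → V) j) ↔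
      i ≠ j ∧ (i = j + 1 ∨ j = i + 1)
    fin_cases i <;> fin_cases j <;> simp [*, hpq.symm, hqr.symm, hrs.symm, hsp.symm, G.adj_comm r p,
      G.adj_comm s q]
  exact h (Set.range f) 4 le_rfl
    ⟨(⟨Equiv.ofInjective f hf, fun {i j} => hadj i j⟩ :
      cycGraph 4 ≃g G.induce (Set.range f)).symm⟩

/-- In a strongly chordal graph every 6-cycle has a chord joining two opposite vertices. -/
theorem IsStronglyChordal.adj_or_adj_or_adj {V : Type} {G : SimpleGraph V}
    (h : IsStronglyChordal G) {v₀ v₁ v₂ v₃ v₄ v₅ : V} (h₀₁ : G.Adj v₀ v₁) (h₁₂ : G.Adj v₁ v₂)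
    (h₂₃ : G.Adj v₂ v₃) (h₃₄ : G.Adj v₃ v₄) (h₄₅ : G.Adj v₄ v₅) (h₅₀ : G.Adj v₅ v₀)
    (h₀₃ : v₀ ≠ v₃) (h₁₄ : v₁ ≠ v₄) (h₂₅ : v₂ ≠ v₅) :
    G.Adj v₀ v₃ ∨ G.Adj v₁ v₄ ∨ G.Adj v₂ v₅ := by
  by_contra! hn
  obtain ⟨hn₀, hn₁, hn₂⟩ := hn
  have hf : Function.Injective (![v₀, v₁, v₂, v₃, v₄, v₅] : Fin 6 → V) := by
    intro i j hij
    fin_cases i <;> fin_cases j <;> simp at hij ⊢ <;> subst hij <;> simp_all [G.adj_comm]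
  have hcyc : ∀ i : Fin 6, G.Adj ((![v₀, v₁, v₂, v₃, v₄, v₅] : Fin 6 → V) i)
      ((![v₀, v₁, v₂, v₃, v₄, v₅] : Fin 6 → V) (i + 1)) := by
    intro i
    fin_cases i <;> simpa
  obtain ⟨i, d, -, hd, hd', hadj⟩ := h.2 6 le_rfl (by decide) _ hf hcyc
  obtain rfl : d = 3 := by omega
  change Fin 6 at i
  change G.Adj ((![v₀, v₁, v₂, v₃, v₄, v₅] : Fin 6 → V) i)
    ((![v₀, v₁, v₂, v₃, v₄, v₅] : Fin 6 → V) (i + 3)) at hadj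
  fin_cases i <;> simp at hadj <;> simp_all [G.adj_comm]

/-- If the 3-sun on `c₁ c₂ c₃` arises by merging the ends of an edge `ab` into the degree-two vertex
opposite to `c₂`, then the original graph is not strongly chordal. -/
theorem IsStronglyChordal.false_of_contract_tip {V : Type} {G : SimpleGraph V}
    (h : IsStronglyChordal G) {a b c₁ c₂ c₃ t₁ t₃ : V} (hab : G.Adj a b) (h₁₃ : G.Adj c₁ c₃)
    (ht₁ : G.Adj t₁ c₁) (ht₁' : G.Adj t₁ c₂) (ht₃ : G.Adj t₃ c₂) (ht₃' : G.Adj t₃ c₃)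
    (hn₁ : ¬ G.Adj t₁ c₃) (hn₃ : ¬ G.Adj t₃ c₁) (ha₂ : ¬ G.Adj a c₂) (hb₂ : ¬ G.Adj b c₂)
    (h₁ : G.Adj a c₁ ∨ G.Adj b c₁) (h₃ : G.Adj a c₃ ∨ G.Adj b c₃)
    (hac₁ : a ≠ c₁) (hac₂ : a ≠ c₂) (hac₃ : a ≠ c₃)
    (hbc₁ : b ≠ c₁) (hbc₂ : b ≠ c₂) (hbc₃ : b ≠ c₃)
    (ht₁c : t₁ ≠ c₃) (ht₃c : t₃ ≠ c₁) : False := by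
  have key : ∀ x, x ≠ c₂ → ¬ G.Adj x c₂ → G.Adj x c₁ → G.Adj x c₃ → False := by
    intro x hx hx₂ hx₁ hx₃
    have := h.adj_or_adj_or_adj hx₁ ht₁.symm ht₁' ht₃.symm ht₃' hx₃.symm hx ht₃c.symm ht₁c
    grind [G.adj_comm]
  have c4 : ∀ x y, x ≠ c₃ → y ≠ c₁ → G.Adj x y → G.Adj x c₁ → G.Adj y c₃ →
      G.Adj x c₃ ∨ G.Adj c₁ y := fun x y hx hy hxy hx₁ hy₃ =>
    h.1.adj_or_adj hx₁ h₁₃ hy₃.symm hxy.symm hx hy.symm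
  grind [G.adj_comm]

/-- If a 3-sun arises by merging the ends of an edge `ab` into a vertex of its central triangle,
then in the original strongly chordal graph `a` is adjacent to the other central vertices. -/
theorem IsStronglyChordal.adj_of_contract_core {V : Type} {G : SimpleGraph V}
    (h : IsStronglyChordal G) {a b c d s t u : V} (hab : G.Adj a b)
    (hcd : G.Adj c d) (hsc : G.Adj s c) (htd : G.Adj t d) (huc : G.Adj u c) (hud : G.Adj u d)
    (hsd : ¬ G.Adj s d) (htc : ¬ G.Adj t c) (hub : ¬ G.Adj u b)
    (hc : G.Adj a c ∨ G.Adj b c) (hd : G.Adj a d ∨ G.Adj b d)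
    (hs : G.Adj a s ∨ G.Adj b s) (ht : G.Adj a t ∨ G.Adj b t)
    (hac : a ≠ c) (had : a ≠ d) (hbc : b ≠ c) (hbs : b ≠ s) (hbt : b ≠ t) (hbu : b ≠ u)
    (hsd' : s ≠ d) (htc' : t ≠ c) : G.Adj a d := by
  by_contra hn
  have hbd' : G.Adj b d := hd.resolve_left hn
  have hbc' : G.Adj b c := by
    rcases hc with hc | hc
    · have := h.1.adj_or_adj hc hcd hbd'.symm hab.symm had hbc.symm
      grind [G.adj_comm]
    · exact hc
  have hbt' : G.Adj b t := by
    rcases ht with ht | ht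
    · have := h.1.adj_or_adj ht htd hbd'.symm hab.symm had hbt.symm
      grind [G.adj_comm]
    · exact ht
  have sun : ∀ x, G.Adj x b → G.Adj x c → ¬ G.Adj x d → x ≠ d → False := by
    intro x hxb hxc hxd hxd'
    have := h.adj_or_adj_or_adj hxb hbt' htd hud.symm huc hxc.symm hxd' hbu htc'
    grind [G.adj_comm]
  by_cases hbs' : G.Adj b s
  · exact sun s hbs'.symm hsc hsd hsd'
  · have has' : G.Adj a s := hs.resolve_right hbs'
    have := h.1.adj_or_adj has' hsc hbc'.symm hab.symm hac hbs.symm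
    exact sun a hab (by grind [G.adj_comm]) hn had

/-- Contracting an edge lowers the chromatic number by at most one. -/
theorem colorable_succ_of_contractEdge {V : Type} {G : SimpleGraph V} {a b : V} {n : ℕ}
    (h : (contractEdge G a b).Colorable n) : G.Colorable (n + 1) := by
  classical
  obtain ⟨c⟩ := h
  have hc : G.Coloring (Option (Fin n)) := Coloring.mk
    (fun x => if hx : x = b then none else some (c ⟨x, hx⟩)) (by
      intro x y hxy
      have := hxy.ne
      by_cases hx : x = b <;> by_cases hy : y = b <;> simp [hx, hy]
      · grind
      · exact c.valid ⟨by simpa using this, Or.inl (Or.inl hxy)⟩)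
  simpa using hc.colorable

instance : DecidableRel S3.Adj := by
  unfold S3
  infer_instance

theorem S3_colorable : S3.Colorable 3 :=
  ⟨Coloring.mk (![1, 0, 2, 1, 0, 2] : Fin 6 → Fin 3) (by decide)⟩

theorem isNClique_four_of_adj {V : Type} {G : SimpleGraph V} {a b c d : V} (hab : G.Adj a b)
    (hcd : G.Adj c d) (hac : G.Adj a c) (had : G.Adj a d) (hbc : G.Adj b c) (hbd : G.Adj b d) :
    ∃ s : Finset V, G.IsNClique 4 s := by
  classical
  refine ⟨{a, b, c, d}, ?_⟩
  refine ((is3Clique_triple_iff.2 ⟨hbc, hbd, hcd⟩).insert ?_)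
  simp [hab, hac, had]

/-- If `G` is chordal and contracting the edge `{a, b}` of `G` yields a graph
isomorphic to `S₃`, then either `G` is not strongly chordal or the clique number of
`G` equals four. -/
theorem statement14 {V : Type} [Fintype V] (G : SimpleGraph V) (hch : IsChordal G)
    (a b : V) (hab : G.Adj a b) (hiso : Nonempty (contractEdge G a b ≃g S3)) :
    ¬ IsStronglyChordal G ∨ ((∃ s : Finset V, G.IsNClique 4 s) ∧ G.CliqueFree 5) := by
  refine or_iff_not_imp_left.2 fun hs => ?_
  replace hs : IsStronglyChordal G := not_not.1 hs
  obtain ⟨e⟩ := hiso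
  have hcol : (contractEdge G a b).Colorable 3 := S3_colorable.of_hom e.toHom
  refine ⟨?_, (colorable_succ_of_contractEdge hcol).cliqueFree (by norm_num)⟩
  obtain ⟨k, hk⟩ : ∃ k, (e.symm k).1 = a := ⟨e ⟨a, hab.ne⟩, by simp⟩
  let w : Fin 6 → V := fun i => (e.symm i).1
  have hwb : ∀ i, b ≠ w i := fun i => (e.symm i).2.symm
  have hwinj : ∀ i j, i ≠ j → w i ≠ w j := fun i j hij h =>
    hij (e.symm.injective (Subtype.ext h))
  have hadj : ∀ i j, S3.Adj i j ↔ i ≠ j ∧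
      ((G.Adj (w i) (w j) ∨ (w i = a ∧ G.Adj b (w j)) ∨ (w j = a ∧ G.Adj b (w i))) ∨
        (G.Adj (w j) (w i) ∨ (w j = a ∧ G.Adj b (w i)) ∨ (w i = a ∧ G.Adj b (w j)))) := by
    intro i j
    rw [← e.symm.map_adj_iff]
    have := e.symm.injective.ne_iff (x := i) (y := j)
    simp only [contractEdge, fromRel_adj]
    exact and_congr_left' this
  have hwa : ∀ i, i ≠ k → a ≠ w i := fun i hi => hk ▸ (hwinj i k hi).symm
  have hout : ∀ i j, i ≠ k → j ≠ k → (G.Adj (w i) (w j) ↔ S3.Adj i j) := by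
    intro i j hi hj
    have := hwa i hi
    have := hwa j hj
    have := hadj i j
    by_cases hij : i = j
    · simp [hij]
    · grind [G.adj_comm]
  have hin : ∀ i, i ≠ k → ((G.Adj a (w i) ∨ G.Adj b (w i)) ↔ S3.Adj k i) := by
    intro i hi
    have := hwa i hi
    have h := hadj k i
    have : w k = a := hk
    grind [G.adj_comm]
  have tip : ∀ c₁ t₁ c₂ t₃ c₃ : Fin 6, S3.Adj c₁ c₃ → S3.Adj t₁ c₁ →
      S3.Adj t₁ c₂ → S3.Adj t₃ c₂ → S3.Adj t₃ c₃ → ¬ S3.Adj t₁ c₃ → ¬ S3.Adj t₃ c₁ →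
      ¬ S3.Adj k c₂ → S3.Adj k c₁ → S3.Adj k c₃ → c₂ ≠ k → t₁ ≠ k → t₃ ≠ k → t₁ ≠ c₃ → t₃ ≠ c₁ →
      False := by
    intro c₁ t₁ c₂ t₃ c₃ h₁₃ ht₁ ht₁' ht₃ ht₃' hn₁ hn₃ hk₂ hk₁ hk₃ hc₂ htk₁ htk₃ htc₁ htc₃
    have hc₁ := hk₁.ne'
    have hc₃ := hk₃.ne'
    rw [← hout _ _ ‹_› ‹_›] at h₁₃ ht₁ ht₁' ht₃ ht₃' hn₁ hn₃
    rw [← hin _ ‹_›] at hk₁ hk₂ hk₃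
    push Not at hk₂
    exact hs.false_of_contract_tip hab h₁₃ ht₁ ht₁' ht₃ ht₃' hn₁ hn₃ hk₂.1 hk₂.2 hk₁ hk₃
      (hwa _ hc₁) (hwa _ hc₂) (hwa _ hc₃) (hwb _) (hwb _) (hwb _) (hwinj _ _ htc₁) (hwinj _ _ htc₃)
  have core : ∀ c d s t u : Fin 6, S3.Adj c d → S3.Adj s c → S3.Adj t d → S3.Adj u c → S3.Adj u d →
      ¬ S3.Adj s d → ¬ S3.Adj t c → ¬ S3.Adj k u → S3.Adj k c → S3.Adj k d → S3.Adj k s →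
      S3.Adj k t → u ≠ k → s ≠ d → t ≠ c → ∃ s : Finset V, G.IsNClique 4 s := by
    intro c d s t u hcd hsc htd huc hud hsd htc hku hkc hkd hks hkt hu hsd' htc'
    have hc := hkc.ne'
    have hd := hkd.ne'
    have hs' := hks.ne'
    have ht := hkt.ne'
    rw [← hout _ _ ‹_› ‹_›] at hcd hsc htd huc hud hsd htc
    rw [← hin _ ‹_›] at hku hkc hkd hks hkt
    push Not at hku
    rw [G.adj_comm a, G.adj_comm b] at hku
    have had := hs.adj_of_contract_core hab hcd hsc htd huc hud hsd htc hku.2 hkc hkd hks hkt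
      (hwa _ hc) (hwa _ hd) (hwb _) (hwb _) (hwb _) (hwb _) (hwinj _ _ hsd') (hwinj _ _ htc')
    have hac := hs.adj_of_contract_core hab hcd.symm htd hsc hud huc htc hsd hku.2 hkd hkc hkt
      hks (hwa _ hd) (hwa _ hc) (hwb _) (hwb _) (hwb _) (hwb _) (hwinj _ _ htc')
      (hwinj _ _ hsd')
    have hbd := hs.adj_of_contract_core hab.symm hcd hsc htd huc hud hsd htc hku.1 hkc.symm
      hkd.symm hks.symm hkt.symm (hwb _) (hwb _) (hwa _ hc) (hwa _ hs') (hwa _ ht) (hwa _ hu)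
      (hwinj _ _ hsd') (hwinj _ _ htc')
    have hbc := hs.adj_of_contract_core hab.symm hcd.symm htd hsc hud huc htc hsd hku.1 hkd.symm
      hkc.symm hkt.symm hks.symm (hwb _) (hwb _) (hwa _ hd) (hwa _ ht) (hwa _ hs') (hwa _ hu)
      (hwinj _ _ htc') (hwinj _ _ hsd')
    exact isNClique_four_of_adj hab hcd hac had hbc hbd
  clear hin hout hwa hadj hk
  fin_cases k
  · exfalso; apply tip 1 2 3 4 5 <;> decide
  · apply core 5 3 0 2 4 <;> decide
  · exfalso; apply tip 3 4 5 0 1 <;> decide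
  · apply core 1 5 2 4 0 <;> decide
  · exfalso; apply tip 5 0 1 2 3 <;> decide
  · apply core 3 1 4 0 2 <;> decide
end
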